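/- Let G=(V,E) be a finite simple graph, let 𝒞 = {C₁, C₂, …, C_s} be the globally 2-linked clusters of G of size at least four, and let F ⊆ E be the set of edges of G not induced by any member of 𝒞. For a pair u,v ∈ V let h_𝒞(uv) be the number of sets in 𝒞 containing both u and v, and let H(𝒞) = { {u,v} : h_𝒞(uv) ≥ 2 }. Then r₂(G) = |F| + Σ_{i=1}^s (2|C_i| − 3) − Σ_{{u,v} ∈ H(𝒞)} (h_𝒞(uv) − 1). Furthermore, 𝒞 has a 3-shellable ordering. -/

import Mathlib

open scoped BigOperators

noncomputable section

namespace Rigidity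

variable {V : Type*}

/-- Euclidean distance between two points of `ℝ^d` (given as coordinate functions). -/
def eDist {d : ℕ} (x y : Fin d → ℝ) : ℝ := Real.sqrt (∑ i, (x i - y i) ^ 2)

/-- Two frameworks `(G,p)` and `(G,q)` are equivalent if corresponding edge lengths agree. -/
def Equivalent {d : ℕ} (G : SimpleGraph V) (p q : V → Fin d → ℝ) : Prop :=
  ∀ u v : V, G.Adj u v → eDist (p u) (p v) = eDist (q u) (q v)

/-- Two placements are congruent if all pairwise distances agree. -/
def Congruent {d : ℕ} (p q : V → Fin d → ℝ) : Prop :=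
  ∀ u v : V, eDist (p u) (p v) = eDist (q u) (q v)

/-- A placement is generic if the multiset of its coordinates is algebraically
independent over `ℚ`. -/
def Generic {d : ℕ} (p : V → Fin d → ℝ) : Prop :=
  AlgebraicIndependent ℚ (fun vi : V × Fin d => p vi.1 vi.2)

/-- `{u,v}` is globally linked in the framework `(G,p)`. -/
def GloballyLinkedIn {d : ℕ} (G : SimpleGraph V) (p : V → Fin d → ℝ) (u v : V) : Prop :=
  ∀ q : V → Fin d → ℝ, Equivalent G p q → eDist (q u) (q v) = eDist (p u) (p v)

/-- `{u,v}` is globally `d`-linked in `G`. -/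
def GloballyLinked (d : ℕ) (G : SimpleGraph V) (u v : V) : Prop :=
  ∀ p : V → Fin d → ℝ, Generic p → GloballyLinkedIn G p u v

/-- The framework `(G,p)` is rigid. -/
def RigidFramework {d : ℕ} (G : SimpleGraph V) (p : V → Fin d → ℝ) : Prop :=
  ∃ ε > (0:ℝ), ∀ q : V → Fin d → ℝ, Equivalent G p q →
    (∀ v, eDist (p v) (q v) < ε) → Congruent p q

/-- `G` is `d`-rigid: every generic framework of `G` in `ℝ^d` is rigid. -/
def IsRigidGraph (d : ℕ) (G : SimpleGraph V) : Prop :=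
  ∀ p : V → Fin d → ℝ, Generic p → RigidFramework G p

/-- The framework `(G,p)` is globally rigid. -/
def GloballyRigidFramework {d : ℕ} (G : SimpleGraph V) (p : V → Fin d → ℝ) : Prop :=
  ∀ q : V → Fin d → ℝ, Equivalent G p q → Congruent p q

/-- The row of the rigidity matrix corresponding to the (ordered) edge `(u,v)`. -/
def edgeVec [DecidableEq V] {d : ℕ} (p : V → Fin d → ℝ) (u v : V) : V × Fin d → ℝ :=
  fun wi => if wi.1 = u then p u wi.2 - p v wi.2
            else if wi.1 = v then p v wi.2 - p u wi.2 else 0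

/-- The rank of the set of rows of the rigidity matrix of `(·,p)` indexed by `F`. -/
def rankAt [DecidableEq V] (d : ℕ) (p : V → Fin d → ℝ) (F : Set (Sym2 V)) : ℕ :=
  Module.finrank ℝ (Submodule.span ℝ
    {x : V × Fin d → ℝ | ∃ u v : V, s(u, v) ∈ F ∧ x = edgeVec p u v})

/-- `r_d(F)`: the rank of the set of rows indexed by `F` of the rigidity matrix of a
generic framework, equivalently the maximum of this rank over all placements. -/
def rd [DecidableEq V] (d : ℕ) (F : Set (Sym2 V)) : ℕ :=
  sSup {n : ℕ | ∃ p : V → Fin d → ℝ, n = rankAt d p F}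

/-- An edge set is `ℛ_d`-independent if its rank equals its cardinality. -/
def RdIndep [DecidableEq V] (d : ℕ) (F : Set (Sym2 V)) : Prop := rd d F = F.ncard

/-- An `ℛ_d`-circuit: not independent, but every proper subset is independent. -/
def RdCircuit [DecidableEq V] (d : ℕ) (C : Set (Sym2 V)) : Prop :=
  ¬ RdIndep d C ∧ ∀ C' : Set (Sym2 V), C' ⊂ C → RdIndep d C'

/-- An `ℛ_d`-circuit of the graph `G`. -/
def RdCircuitOf [DecidableEq V] (d : ℕ) (G : SimpleGraph V) (C : Set (Sym2 V)) : Prop :=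
  C ⊆ G.edgeSet ∧ RdCircuit d C

/-- `F` is (the edge set of) an `ℛ_d`-component of `G`: an equivalence class of the
relation "`e = f` or some `ℛ_d`-circuit of `G` contains both `e` and `f`". -/
def IsRdComponent [DecidableEq V] (d : ℕ) (G : SimpleGraph V) (F : Set (Sym2 V)) : Prop :=
  ∃ e ∈ G.edgeSet, F = {f | f ∈ G.edgeSet ∧
    (e = f ∨ ∃ C, RdCircuitOf d G C ∧ e ∈ C ∧ f ∈ C)}

/-- The set of vertices covered by an edge set. -/
def vertexSpan (F : Set (Sym2 V)) : Set V := {v | ∃ e ∈ F, v ∈ e}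

/-- A nonempty edge set is `ℛ_d`-connected if any two of its edges lie on a common
`ℛ_d`-circuit contained in it (or are equal). -/
def RdConnectedSet [DecidableEq V] (d : ℕ) (F : Set (Sym2 V)) : Prop :=
  F.Nonempty ∧ ∀ e ∈ F, ∀ f ∈ F, e = f ∨ ∃ C, C ⊆ F ∧ RdCircuit d C ∧ e ∈ C ∧ f ∈ C

/-- A graph (with at least one edge) is `ℛ_d`-connected. -/
def RdConnected [DecidableEq V] (d : ℕ) (H : SimpleGraph V) : Prop :=
  RdConnectedSet d H.edgeSet

/-- `e` is an `ℛ_d`-bridge of `G`: `r_d(E ∖ {e}) = r_d(E) − 1`. -/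
def IsRdBridge [DecidableEq V] (d : ℕ) (G : SimpleGraph V) (e : Sym2 V) : Prop :=
  e ∈ G.edgeSet ∧ rd d (G.edgeSet \ {e}) + 1 = rd d G.edgeSet

/-- `G + uv`. -/
def addEdge (G : SimpleGraph V) (u v : V) : SimpleGraph V :=
  G ⊔ SimpleGraph.fromEdgeSet {s(u, v)}

/-- `{u,v}` is `d`-linked in `G` if `r_d(G+uv) = r_d(G)`. -/
def IsLinked [DecidableEq V] (d : ℕ) (G : SimpleGraph V) (u v : V) : Prop :=
  rd d (addEdge G u v).edgeSet = rd d G.edgeSet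

/-- There exist `k` pairwise internally vertex-disjoint `u`–`v` paths in `H`
(i.e. `κ_H(u,v) ≥ k`). -/
def InternallyDisjointPaths (H : SimpleGraph V) (u v : V) (k : ℕ) : Prop :=
  ∃ P : Fin k → H.Walk u v, (∀ i, (P i).IsPath) ∧
    ∀ i j, i ≠ j → ∀ w, w ∈ (P i).support → w ∈ (P j).support → w = u ∨ w = v

/-- An unordered pair forming a 2-separator: two distinct vertices whose deletion
disconnects the graph. -/
def TwoSepPair (H : SimpleGraph V) (e : Sym2 V) : Prop :=
  ¬ e.IsDiag ∧ ¬ (H.induce {v | v ∉ e}).Connected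

/-- The augmented graph `Ĥ`: add an edge for every 2-separator. -/
def aug (H : SimpleGraph V) : SimpleGraph V :=
  H ⊔ SimpleGraph.fromEdgeSet {e | TwoSepPair H e}

/-- A subgraph is 3-connected: at least 4 vertices, and deleting fewer than 3
vertices leaves it connected. -/
def IsThreeConnectedSubgraph {G : SimpleGraph V} (J : G.Subgraph) : Prop :=
  4 ≤ J.verts.ncard ∧ ∀ S : Set V, S.ncard < 3 → (J.deleteVerts S).coe.Connected

/-- A 3-block of `H`: a maximal 3-connected subgraph of the augmented graph `Ĥ`. -/
def IsThreeBlock (H : SimpleGraph V) (J : (aug H).Subgraph) : Prop :=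
  IsThreeConnectedSubgraph J ∧
    ∀ J' : (aug H).Subgraph, IsThreeConnectedSubgraph J' → J ≤ J' → J = J'

/-- `h_H(e)`: the number of 3-blocks of `H` containing both vertices of `e`. -/
def numBlocksOn (H : SimpleGraph V) (e : Sym2 V) : ℕ :=
  {J : (aug H).Subgraph | IsThreeBlock H J ∧ ∀ v ∈ e, v ∈ J.verts}.ncard

open Classical in
/-- `k(H) = Σ (h_H(ab) − 1)` over all 2-separators `{a,b}` of `H`. -/
def kGraph [Fintype V] [DecidableEq V] (H : SimpleGraph V) : ℕ :=
  ∑ e : Sym2 V, if TwoSepPair H e then numBlocksOn H e - 1 else 0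

/-- The graph of an `ℛ₂`-component, on its own vertex set. -/
def componentGraph [DecidableEq V] (F : Set (Sym2 V)) :
    SimpleGraph (vertexSpan F) :=
  (SimpleGraph.fromEdgeSet F).induce (vertexSpan F)

/-- `X` is the vertex set of an `ℛ_d`-block of `G`: a 3-block of a non-trivial
`ℛ_d`-component of `G`. -/
def IsRdBlockVerts [DecidableEq V] (d : ℕ) (G : SimpleGraph V) (X : Set V) : Prop :=
  ∃ F : Set (Sym2 V), IsRdComponent d G F ∧ 2 ≤ F.ncard ∧
    ∃ J : (aug (componentGraph F)).Subgraph,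
      IsThreeBlock (componentGraph F) J ∧ X = Subtype.val '' J.verts

/-- The globally linked closure of `G` in `ℝ^d`. -/
def glc (d : ℕ) (G : SimpleGraph V) : SimpleGraph V :=
  G ⊔ SimpleGraph.fromEdgeSet {e | ∃ u v : V, e = s(u, v) ∧ GloballyLinked d G u v}

/-- A globally `d`-linked cluster: the vertex set of a maximal complete subgraph of
`glc_d(G)`. -/
def IsCluster (d : ℕ) (G : SimpleGraph V) (X : Set V) : Prop :=
  (∀ a ∈ X, ∀ b ∈ X, a ≠ b → (glc d G).Adj a b) ∧
    ∀ Y : Set V, X ⊆ Y → (∀ a ∈ Y, ∀ b ∈ Y, a ≠ b → (glc d G).Adj a b) → Y = X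

/-- Equilibrium stress of a framework, encoded as a symmetric function vanishing on
non-edges. -/
def IsEqStress [Fintype V] {d : ℕ} (G : SimpleGraph V) (p : V → Fin d → ℝ)
    (ω : V → V → ℝ) : Prop :=
  (∀ u v, ω u v = ω v u) ∧ (∀ u v, ¬ G.Adj u v → ω u v = 0) ∧
    ∀ u, ∑ v, ω u v • (p u - p v) = 0

/-- `{u,v}` is `d`-stress-linked in `G`. -/
def StressLinked [Fintype V] (d : ℕ) (G : SimpleGraph V) (u v : V) : Prop :=
  ∀ p : V → Fin d → ℝ, Generic p → ∀ q : V → Fin d → ℝ,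
    (∀ ω, IsEqStress G p ω → IsEqStress G q ω) →
    ∀ ω, IsEqStress (addEdge G u v) p ω → IsEqStress (addEdge G u v) q ω

/-- Equivalence of complex frameworks. -/
def CEquivalent {d : ℕ} (G : SimpleGraph V) (p q : V → Fin d → ℂ) : Prop :=
  ∀ u v : V, G.Adj u v →
    ∑ i, (p u i - p v i) ^ 2 = ∑ i, (q u i - q v i) ^ 2

/-- Generic complex placement. -/
def CGeneric {d : ℕ} (p : V → Fin d → ℂ) : Prop :=
  AlgebraicIndependent ℚ (fun vi : V × Fin d => p vi.1 vi.2)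

/-- `{u,v}` is globally linked in `G` in `ℂ^d`. -/
def CGloballyLinked (d : ℕ) (G : SimpleGraph V) (u v : V) : Prop :=
  ∀ p : V → Fin d → ℂ, CGeneric p → ∀ q : V → Fin d → ℂ, CEquivalent G p q →
    ∑ i, (q u i - q v i) ^ 2 = ∑ i, (p u i - p v i) ^ 2

/-- A flexing of the framework `(G,q)`. -/
def IsFlexing {d : ℕ} (G : SimpleGraph V) (q : V → Fin d → ℝ)
    (φ : Set.Icc (0:ℝ) 1 → V → Fin d → ℝ) : Prop :=
  Continuous φ ∧ φ ⟨0, Set.left_mem_Icc.mpr zero_le_one⟩ = q ∧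
    (∀ t, Equivalent G q (φ t)) ∧
    ∀ t : Set.Icc (0:ℝ) 1, 0 < (t : ℝ) → ¬ Congruent q (φ t)

/-- A finite loopless multigraph on vertex type `V` with edge type `E`. -/
structure Multigraph (V : Type*) (E : Type*) where
  ends : E → Sym2 V
  loopless : ∀ e, ¬ (ends e).IsDiag

/-- The data `(B, bar)` exhibits `G` as a body-bar graph induced by `H`. -/
def IsBodyBar {V E W : Type*} (H : Multigraph V E) (G : SimpleGraph W)
    (B : V → Set W) (bar : E → W × W) : Prop :=
  (∀ w : W, ∃! v : V, w ∈ B v) ∧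
  (∀ v : V, (B v).ncard = {e : E | v ∈ H.ends e}.ncard) ∧
  (∀ e : E, ∃ w z : V, H.ends e = s(w, z) ∧ (bar e).1 ∈ B w ∧ (bar e).2 ∈ B z) ∧
  (∀ e : E, (bar e).1 ≠ (bar e).2) ∧
  (∀ e e' : E, e ≠ e' →
    ({(bar e).1, (bar e).2} ∩ {(bar e').1, (bar e').2} : Set W) = ∅) ∧
  (∀ a b : W, G.Adj a b ↔ a ≠ b ∧
    ((∃ v : V, a ∈ B v ∧ b ∈ B v) ∨ ∃ e : E, s(a, b) = s((bar e).1, (bar e).2)))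

/-- `P` is a partition of the set `X`. -/
def IsPartitionOf {V : Type*} (X : Set V) (P : Set (Set V)) : Prop :=
  (∀ p ∈ P, p.Nonempty ∧ p ⊆ X) ∧ ∀ v ∈ X, ∃! p, p ∈ P ∧ v ∈ p

/-- The subgraph `(X,F)` of the multigraph `H` is `k`-tree-connected. -/
def SubTreeConnected {V E : Type*} (k : ℕ) (H : Multigraph V E)
    (X : Set V) (F : Set E) : Prop :=
  X.Nonempty ∧ (∀ e ∈ F, ∀ v ∈ H.ends e, v ∈ X) ∧
    ∀ P : Set (Set V), IsPartitionOf X P →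
      k * (P.ncard - 1) ≤ {e | e ∈ F ∧ ¬ ∃ p ∈ P, ∀ v ∈ H.ends e, v ∈ p}.ncard

/-- `(X,F)` is a `k`-superbrick of `H`: a maximal `k`-tree-connected subgraph. -/
def IsSuperbrick {V E : Type*} (k : ℕ) (H : Multigraph V E)
    (X : Set V) (F : Set E) : Prop :=
  SubTreeConnected k H X F ∧
    ∀ X' F', SubTreeConnected k H X' F' → X ⊆ X' → F ⊆ F' → X = X' ∧ F = F'

set_option linter.unusedSectionVars false

/-- Lifting along a formally smooth ring homomorphism, phrased with bare ring homomorphisms. -/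
theorem exists_ringHom_lift {A L B : Type*} [CommRing A] [CommRing L] [CommRing B] [Algebra A L]
    [Algebra.FormallySmooth A L] (π : B →+* L) (hπ : Function.Surjective π)
    (hker : IsNilpotent (RingHom.ker π)) (φ : A →+* B) (hφ : π.comp φ = algebraMap A L) :
    ∃ ψ : L →+* B, ψ.comp (algebraMap A L) = φ ∧ π.comp ψ = RingHom.id L := by
  let := φ.toAlgebra
  let π' : B →ₐ[A] L := { π with commutes' := fun a => RingHom.congr_fun hφ a }
  let ψ := Algebra.FormallySmooth.liftOfSurjective (AlgHom.id A L) π' hπ hker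
  refine ⟨ψ.toRingHom, ?_, ?_⟩
  · ext a
    exact ψ.commutes a
  · ext x
    exact Algebra.FormallySmooth.liftOfSurjective_apply (AlgHom.id A L) π' hπ hker x

/-- In characteristic zero, a transcendental element is detected by a derivation. -/
theorem exists_derivation_ne_zero {K L : Type*} [Field K] [Field L] [CharZero K] [Algebra K L]
    {g : L} (hg : Transcendental K g) : ∃ D : Derivation K L L, D g ≠ 0 := by
  classical
  have hs : AlgebraicIndepOn K id ({g} : Set L) := by
    have := (algebraicIndependent_singleton_iff (R := K) (x := fun i : ({g} : Set L) => (i : L))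
      ⟨g, rfl⟩).2 hg
    exact this
  obtain ⟨t, hst, ht⟩ := exists_isTranscendenceBasis_superset hs
  let g' : t := ⟨g, hst rfl⟩
  let : Algebra (MvPolynomial t K) L := (MvPolynomial.aeval (Subtype.val : t → L)).toAlgebra
  have : IsScalarTower K (MvPolynomial t K) L := IsScalarTower.of_algebraMap_eq fun x => by
    rw [RingHom.algebraMap_toAlgebra]; simp
  have hv : AlgebraicIndependent K (Subtype.val : t → L) := ht.1
  have : Algebra.FormallySmooth (MvPolynomial t K) L := by
    let F := IntermediateField.adjoin K (Set.range (Subtype.val : t → L))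
    let R := Algebra.adjoin K (Set.range (Subtype.val : t → L))
    let : Algebra R F := (Subalgebra.inclusion (IntermediateField.algebra_adjoin_le_adjoin K _)).toAlgebra
    have : Algebra.IsAlgebraic F L := ht.isAlgebraic_field
    have : Algebra.IsSeparable F L := inferInstance
    let e := hv.aevalEquiv
    let : Algebra (MvPolynomial t K) R := e.toAlgHom.toAlgebra
    have : IsScalarTower (MvPolynomial t K) R L := IsScalarTower.of_algebraMap_eq fun x => by
      rw [RingHom.algebraMap_toAlgebra, RingHom.algebraMap_toAlgebra]
      exact (hv.algebraMap_aevalEquiv x).symm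
    have : Algebra.FormallyEtale (MvPolynomial t K) R :=
      Algebra.FormallyEtale.of_equiv (A := MvPolynomial t K)
        (AlgEquiv.ofBijective (Algebra.ofId _ _) e.bijective)
    open scoped IntermediateField.algebraAdjoinAdjoin in
    have h2 : Algebra.FormallyEtale R F := .of_isLocalization (nonZeroDivisors _)
    have h3 : Algebra.FormallyEtale F L := Algebra.FormallyEtale.of_isSeparable _ L
    have : IsScalarTower R F L := IsScalarTower.of_algebraMap_eq fun x => rfl
    have : Algebra.FormallyEtale R L := .comp _ F _
    have : Algebra.FormallyEtale (MvPolynomial t K) L := .comp _ R _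
    infer_instance
  let φ : MvPolynomial t K →ₐ[K] DualNumber L :=
    MvPolynomial.aeval fun i => TrivSqZeroExt.inl (i : L) + if i = g' then DualNumber.eps else 0
  let π : DualNumber L →ₐ[K] L := TrivSqZeroExt.fstHom K L L
  obtain ⟨ψ, hψ₁, hψ₂⟩ := exists_ringHom_lift (A := MvPolynomial t K) π.toRingHom
    (fun x => ⟨TrivSqZeroExt.inl x, rfl⟩)
    ⟨2, by
      rw [pow_two, Ideal.zero_eq_bot, eq_bot_iff, Ideal.mul_le]
      intro a ha b hb
      have ha' : a.fst = 0 := ha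
      have hb' : b.fst = 0 := hb
      rw [Ideal.mem_bot]
      ext <;> simp [ha', hb']⟩ φ.toRingHom (by
      have : π.comp φ = MvPolynomial.aeval (Subtype.val : t → L) := by
        ext i
        by_cases h : i = g' <;> simp [φ, π, h]
      exact congrArg AlgHom.toRingHom this)
  have hfst : ∀ x, (ψ x).fst = x := fun x => RingHom.congr_fun hψ₂ x
  have halg : ∀ k : K, ψ (algebraMap K L k) = algebraMap K _ k := fun k => by
    have := RingHom.congr_fun hψ₁ (algebraMap K _ k)
    rw [RingHom.comp_apply, ← IsScalarTower.algebraMap_apply] at this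
    rw [this]; exact φ.commutes k
  let D : Derivation K L L := Derivation.mk'
    { toFun := fun x => (ψ x).snd
      map_add' := fun x y => by simp
      map_smul' := fun k x => by
        rw [Algebra.smul_def, map_mul, halg]
        have h : algebraMap K (DualNumber L) k = TrivSqZeroExt.inl (algebraMap K L k) := rfl
        simp [TrivSqZeroExt.snd_mul, Algebra.smul_def, h] }
    (fun x y => by
      simp [TrivSqZeroExt.snd_mul, hfst, mul_comm])
  refine ⟨D, ?_⟩
  have : ψ g = φ (MvPolynomial.X g') := by
    rw [← show (φ.toRingHom : MvPolynomial t K →+* _) (MvPolynomial.X g') = φ (MvPolynomial.X g') from rfl, ← hψ₁]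
    simp [RingHom.algebraMap_toAlgebra, g']
  change (ψ g).snd ≠ 0
  rw [this]
  simp [φ]

section

/-- Squared edge lengths. -/
def lenSq (q : V → Fin 2 → ℝ) : Sym2 V → ℝ :=
  Sym2.lift ⟨fun u v => ∑ i, (q u i - q v i) ^ 2, fun u v => by
    refine Finset.sum_congr rfl fun i _ => by ring⟩

theorem lenSq_mk (q : V → Fin 2 → ℝ) (u v : V) : lenSq q s(u, v) = ∑ i, (q u i - q v i) ^ 2 := rfl

theorem eDist_eq_iff (p q : V → Fin 2 → ℝ) (u v : V) :
    eDist (p u) (p v) = eDist (q u) (q v) ↔ lenSq p s(u, v) = lenSq q s(u, v) :=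
  Real.sqrt_inj (Finset.sum_nonneg fun _ _ => sq_nonneg _) (Finset.sum_nonneg fun _ _ => sq_nonneg _)

theorem equivalent_iff (G : SimpleGraph V) (p q : V → Fin 2 → ℝ) :
    Equivalent G p q ↔ ∀ e ∈ G.edgeSet, lenSq q e = lenSq p e := by
  refine ⟨fun h e => ?_, fun h u v huv => ?_⟩
  · induction e with | _ u v => exact fun huv => ((eDist_eq_iff p q u v).1 (h u v huv)).symm
  · exact (eDist_eq_iff p q u v).2 (h s(u, v) huv).symm

/-- The polynomial expressing a squared length in terms of the coordinates. -/
def lenPoly : Sym2 V → MvPolynomial (V × Fin 2) ℚ :=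
  Sym2.lift ⟨fun u v => ∑ i, (MvPolynomial.X (u, i) - MvPolynomial.X (v, i)) ^ 2, fun u v => by
    refine Finset.sum_congr rfl fun i _ => by ring⟩

theorem aeval_lenPoly (q : V → Fin 2 → ℝ) (e : Sym2 V) :
    MvPolynomial.aeval (fun vi : V × Fin 2 => q vi.1 vi.2) (lenPoly e) = lenSq q e := by
  induction e with | _ u v => simp [lenPoly, lenSq_mk]

variable [Fintype V] [DecidableEq V]

/-- The linear map sending a stress to its resultant forces. -/
def forceMap (p : V → Fin 2 → ℝ) : (Sym2 V → ℝ) →ₗ[ℝ] (V × Fin 2 → ℝ) where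
  toFun ω ui := ∑ w, ω s(ui.1, w) * (p ui.1 ui.2 - p w ui.2)
  map_add' ω η := by
    ext ui
    simp [add_mul, Finset.sum_add_distrib]
  map_smul' c ω := by
    ext ui
    simp [mul_assoc, Finset.mul_sum]

theorem forceMap_apply (p : V → Fin 2 → ℝ) (ω : Sym2 V → ℝ) (u : V) (i : Fin 2) :
    forceMap p ω (u, i) = ∑ w, ω s(u, w) * (p u i - p w i) := rfl

/-- The row of the rigidity matrix indexed by an unordered pair. -/
def row (p : V → Fin 2 → ℝ) (e : Sym2 V) : V × Fin 2 → ℝ := forceMap p (Pi.single e 1)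

theorem row_mk (p : V → Fin 2 → ℝ) (u v : V) : row p s(u, v) = edgeVec p u v := by
  ext ⟨w, i⟩
  rw [row, forceMap_apply]
  unfold edgeVec
  dsimp only
  split_ifs with h1 h2
  · subst h1
    rw [Finset.sum_eq_single v]
    · simp
    · intro x _ hx
      rw [Pi.single_eq_of_ne, zero_mul]
      simp only [ne_eq, Sym2.eq_iff]
      grind
    · simp
  · subst h2
    rw [Finset.sum_eq_single u]
    · rw [Sym2.eq_swap]; simp
    · intro x _ hx
      rw [Pi.single_eq_of_ne, zero_mul]
      simp only [ne_eq, Sym2.eq_iff]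
      tauto
    · simp
  · refine Finset.sum_eq_zero fun x _ => ?_
    rw [Pi.single_eq_of_ne, zero_mul]
    simp only [ne_eq, Sym2.eq_iff]
    tauto

theorem forceMap_eq_sum (p : V → Fin 2 → ℝ) (ω : Sym2 V → ℝ) :
    forceMap p ω = ∑ e, ω e • row p e := by
  rw [LinearMap.pi_apply_eq_sum_univ]
  refine Finset.sum_congr rfl fun e _ => ?_
  rw [row]
  congr 2
  ext f
  simp [Pi.single_apply, eq_comm]

/-- Pairing a row with a vector of velocities. -/
theorem row_dotProduct (p : V → Fin 2 → ℝ) (m : V × Fin 2 → ℝ) (u v : V) :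
    row p s(u, v) ⬝ᵥ m = ∑ i, (p u i - p v i) * (m (u, i) - m (v, i)) := by
  rw [row_mk, dotProduct, Fintype.sum_prod_type, Finset.sum_comm]
  refine Finset.sum_congr rfl fun i _ => ?_
  by_cases huv : u = v
  · subst huv
    simp [edgeVec]
  rw [Finset.sum_eq_add u v huv]
  · simp [edgeVec, Ne.symm huv]; ring
  · rintro w - ⟨h1, h2⟩
    simp [edgeVec, h1, h2]
  · simp
  · simp

/-- The span of the rows indexed by a set of pairs. -/
def rowSpan (p : V → Fin 2 → ℝ) (E : Set (Sym2 V)) : Submodule ℝ (V × Fin 2 → ℝ) :=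
  Submodule.span ℝ (row p '' E)

theorem rankAt_eq (p : V → Fin 2 → ℝ) (E : Set (Sym2 V)) :
    rankAt 2 p E = Module.finrank ℝ (rowSpan p E) := by
  unfold rankAt rowSpan
  suffices h : {x : V × Fin 2 → ℝ | ∃ u v : V, s(u, v) ∈ E ∧ x = edgeVec p u v} = row p '' E by
    rw [h]
  ext x
  constructor
  · rintro ⟨u, v, h, rfl⟩
    exact ⟨_, h, row_mk p u v⟩
  · rintro ⟨e, h, rfl⟩
    induction e with | _ u v => exact ⟨u, v, h, row_mk p u v⟩

theorem rowSpan_mono (p : V → Fin 2 → ℝ) {E E' : Set (Sym2 V)} (h : E ⊆ E') :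
    rowSpan p E ≤ rowSpan p E' := Submodule.span_mono (Set.image_mono h)

theorem row_mem_rowSpan (p : V → Fin 2 → ℝ) {E : Set (Sym2 V)} {e : Sym2 V} (h : e ∈ E) :
    row p e ∈ rowSpan p E := Submodule.subset_span ⟨e, h, rfl⟩

/-- Functions supported on a given set of pairs. -/
def suppOn (E : Set (Sym2 V)) : Submodule ℝ (Sym2 V → ℝ) where
  carrier := {ω | ∀ e ∉ E, ω e = 0}
  add_mem' ha hb e he := by simp [ha e he, hb e he]
  zero_mem' _ _ := rfl
  smul_mem' c ω h e he := by simp [h e he]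

theorem map_suppOn (p : V → Fin 2 → ℝ) (E : Set (Sym2 V)) :
    (suppOn E).map (forceMap p) = rowSpan p E := by
  apply le_antisymm
  · rintro _ ⟨ω, hω, rfl⟩
    rw [forceMap_eq_sum]
    refine Submodule.sum_mem _ fun e _ => ?_
    by_cases he : e ∈ E
    · exact Submodule.smul_mem _ _ (row_mem_rowSpan p he)
    · rw [hω e he, zero_smul]; exact Submodule.zero_mem _
  · refine Submodule.span_le.2 ?_
    rintro _ ⟨e, he, rfl⟩
    refine ⟨Pi.single e 1, fun f hf => Pi.single_eq_of_ne ?_ _, rfl⟩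
    rintro rfl; exact hf he

theorem finrank_suppOn (E : Set (Sym2 V)) : Module.finrank ℝ (suppOn E) = E.ncard := by
  classical
  let f : (E → ℝ) ≃ₗ[ℝ] suppOn E :=
    { toFun := fun x => ⟨fun e => if h : e ∈ E then x ⟨e, h⟩ else 0, fun e he => by simp [he]⟩
      map_add' := fun x y => by ext e; by_cases h : e ∈ E <;> simp [h]
      map_smul' := fun c y => by ext e; by_cases h : e ∈ E <;> simp [h]
      invFun := fun ω e => ω.1 e
      left_inv := fun x => by ext e; simp
      right_inv := fun ω => by
        ext e; by_cases h : e ∈ E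
        · simp [h]
        · simp [h, ω.2 e h] }
  rw [← f.finrank_eq, Module.finrank_fintype_fun_eq_card, Set.ncard_eq_toFinset_card', Set.toFinset_card]

/-- The space of equilibrium stresses supported on a set of pairs. -/
def stress (p : V → Fin 2 → ℝ) (E : Set (Sym2 V)) : Submodule ℝ (Sym2 V → ℝ) :=
  LinearMap.ker (forceMap p) ⊓ suppOn E

theorem stress_mono (p : V → Fin 2 → ℝ) {E E' : Set (Sym2 V)} (h : E ⊆ E') :
    stress p E ≤ stress p E' := fun _ hω => ⟨hω.1, fun e he => hω.2 e fun h' => he (h h')⟩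

theorem finrank_rowSpan_add (p : V → Fin 2 → ℝ) (E : Set (Sym2 V)) :
    Module.finrank ℝ (rowSpan p E) + Module.finrank ℝ (stress p E) = E.ncard := by
  rw [← finrank_suppOn, ← LinearMap.finrank_range_add_finrank_ker ((forceMap p).domRestrict (suppOn E)),
    ← map_suppOn, LinearMap.range_domRestrict]
  congr 1
  rw [LinearMap.ker_domRestrict]
  have : (LinearMap.ker (forceMap p)).submoduleOf (suppOn E) =
    (LinearMap.ker (forceMap p)).comap (suppOn E).subtype := rfl
  rw [stress, inf_comm, ← Submodule.map_comap_subtype]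
  exact (Submodule.equivMapOfInjective _ (Submodule.injective_subtype _) _).finrank_eq.symm

theorem linearIndepOn_row_iff (p : V → Fin 2 → ℝ) (E : Set (Sym2 V)) :
    LinearIndepOn ℝ (row p) E ↔ stress p E = ⊥ := by
  have h := finrank_rowSpan_add p E
  rw [← Submodule.finrank_eq_zero (R := ℝ)]
  have h2 : LinearIndepOn ℝ (row p) E ↔ Module.finrank ℝ (rowSpan p E) = E.ncard := by
    classical
    rw [LinearIndepOn, linearIndependent_iff_card_eq_finrank_span, Set.finrank,
      Set.ncard_eq_toFinset_card', Set.toFinset_card, eq_comm]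
    unfold rowSpan
    rw [show (Set.range fun i : E => row p i) = row p '' E by ext; simp]
  rw [h2]; omega

/-- A pair whose row is a combination of the rows of `E`. -/
def InCl (p : V → Fin 2 → ℝ) (E : Set (Sym2 V)) (e : Sym2 V) : Prop := row p e ∈ rowSpan p E

theorem InCl.mono {p : V → Fin 2 → ℝ} {E E' : Set (Sym2 V)} {e : Sym2 V} (h : InCl p E e)
    (hE : E ⊆ E') : InCl p E' e := rowSpan_mono p hE h

theorem InCl.trans {p : V → Fin 2 → ℝ} {E E' : Set (Sym2 V)} {e : Sym2 V} (h : InCl p E e)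
    (hE : ∀ f ∈ E, InCl p E' f) : InCl p E' e := by
  refine (Submodule.span_le.2 ?_ : rowSpan p E ≤ _) h
  rintro _ ⟨f, hf, rfl⟩
  exact hE f hf

theorem inCl_iff_finrank (p : V → Fin 2 → ℝ) (E : Set (Sym2 V)) (e : Sym2 V) :
    InCl p E e ↔ Module.finrank ℝ (rowSpan p (insert e E)) = Module.finrank ℝ (rowSpan p E) := by
  constructor
  · intro h
    have : rowSpan p (insert e E) = rowSpan p E := by
      refine le_antisymm (Submodule.span_le.2 ?_) (rowSpan_mono p (Set.subset_insert e E))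
      rintro _ ⟨f, rfl | hf, rfl⟩
      · exact h
      · exact row_mem_rowSpan p hf
    rw [this]
  · intro h
    have := Submodule.eq_of_le_of_finrank_eq (rowSpan_mono p (Set.subset_insert e E)) h.symm
    rw [InCl, this]
    exact row_mem_rowSpan p (Set.mem_insert e E)

/-- A stress that is nonzero on `e` puts `e` in the closure of the rest of its support. -/
theorem inCl_of_stress {p : V → Fin 2 → ℝ} {E : Set (Sym2 V)} {e : Sym2 V} {ω : Sym2 V → ℝ}
    (hω : forceMap p ω = 0) (he : ω e ≠ 0) (hE : ∀ f, f ≠ e → ω f ≠ 0 → f ∈ E) : InCl p E e := by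
  rw [forceMap_eq_sum, ← Finset.add_sum_erase _ _ (Finset.mem_univ e)] at hω
  have h1 : ω e • row p e = -∑ f ∈ Finset.univ.erase e, ω f • row p f := eq_neg_of_add_eq_zero_left hω
  have h2 : ω e • row p e ∈ rowSpan p E := by
    rw [h1]
    refine Submodule.neg_mem _ (Submodule.sum_mem _ fun f hf => ?_)
    by_cases h0 : ω f = 0
    · simp [h0]
    · exact Submodule.smul_mem _ _ (row_mem_rowSpan p (hE f (Finset.ne_of_mem_erase hf) h0))
  exact (Submodule.smul_mem_iff _ he).1 h2

/-- A pair in the closure of `E` carries a stress of `E` together with that pair. -/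
theorem InCl.exists_stress {p : V → Fin 2 → ℝ} {E : Set (Sym2 V)} {e : Sym2 V} (h : InCl p E e)
    (he : e ∉ E) : ∃ ω ∈ stress p (insert e E), ω e ≠ 0 := by
  rw [InCl, ← map_suppOn] at h
  obtain ⟨ω, hω, hωe⟩ := h
  refine ⟨Pi.single e 1 - ω, ⟨?_, fun f hf => ?_⟩, ?_⟩
  · change forceMap p _ = 0
    rw [map_sub, hωe, row, sub_self]
  · rw [Set.mem_insert_iff, not_or] at hf
    simp [hf.1, hω f hf.2]
  · simp [hω e he]

end

section

/-- Evaluation of a polynomial in the coordinates of a placement. -/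
abbrev evalAt (p : V → Fin 2 → ℝ) : MvPolynomial (V × Fin 2) ℚ →ₐ[ℚ] ℝ :=
  MvPolynomial.aeval fun vi : V × Fin 2 => p vi.1 vi.2

theorem Generic.evalAt_ne_zero {p : V → Fin 2 → ℝ} (hp : Generic p) (p' : V → Fin 2 → ℝ)
    {P : MvPolynomial (V × Fin 2) ℚ} (h : evalAt p' P ≠ 0) : evalAt p P ≠ 0 := by
  intro h0
  have : P = 0 := algebraicIndependent_iff.1 hp P h0
  simp [this] at h

theorem Generic.eq_zero {p : V → Fin 2 → ℝ} (hp : Generic p)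
    {P : MvPolynomial (V × Fin 2) ℚ} (h : evalAt p P = 0) : P = 0 := algebraicIndependent_iff.1 hp P h

variable [Fintype V] [DecidableEq V]

theorem exists_generic : ∃ p : V → Fin 2 → ℝ, Generic p := by
  obtain ⟨s, hs⟩ := exists_isTranscendenceBasis ℚ ℝ
  have hinf : Infinite s := by
    by_contra hfin
    rw [not_infinite_iff_finite] at hfin
    have halg : Algebra.IsAlgebraic (Algebra.adjoin ℚ (Set.range (Subtype.val : s → ℝ))) ℝ :=
      hs.isAlgebraic
    have h1 := Algebra.IsAlgebraic.cardinalMk_le_max (Algebra.adjoin ℚ (Set.range (Subtype.val : s → ℝ))) ℝ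
    have h2 : Cardinal.mk (Algebra.adjoin ℚ (Set.range (Subtype.val : s → ℝ))) ≤ Cardinal.aleph0 := by
      rw [Algebra.adjoin_range_eq_range_aeval]
      refine (Cardinal.mk_range_le (f := (MvPolynomial.aeval (Subtype.val : s → ℝ) :
        MvPolynomial s ℚ →ₐ[ℚ] ℝ))).trans ?_
      have := MvPolynomial.cardinalMk_le_max (σ := s) (R := ℚ)
      refine this.trans ?_
      simp
    have h3 := h1.trans (max_le h2 le_rfl)
    rw [Cardinal.mk_real] at h3
    exact absurd h3 (not_le.2 Cardinal.aleph0_lt_continuum)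
  let f : V × Fin 2 ↪ s := (Fintype.equivFin _).toEmbedding.trans
    ((Fin.valEmbedding).trans (Infinite.natEmbedding s))
  exact ⟨fun v i => f (v, i), hs.1.comp f f.injective⟩

/-- The entries of the rigidity matrix as polynomials. -/
def rowPoly (e : Sym2 V) (ui : V × Fin 2) : MvPolynomial (V × Fin 2) ℚ :=
  ∑ w, (Pi.single e 1 : Sym2 V → MvPolynomial (V × Fin 2) ℚ) s(ui.1, w) *
    (MvPolynomial.X ui - MvPolynomial.X (w, ui.2))

theorem evalAt_rowPoly (p : V → Fin 2 → ℝ) (e : Sym2 V) (ui : V × Fin 2) :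
    evalAt p (rowPoly e ui) = row p e ui := by
  simp only [rowPoly, map_sum, map_mul, map_sub, MvPolynomial.aeval_X, row]
  refine Finset.sum_congr rfl fun w _ => ?_
  congr 1
  by_cases h : s(ui.1, w) = e
  · subst h; simp
  · rw [Pi.single_eq_of_ne h, Pi.single_eq_of_ne h, map_zero]

/-- Generic placements have as many independent rows as possible. -/
theorem Generic.linearIndepOn {p : V → Fin 2 → ℝ} (hp : Generic p) {p' : V → Fin 2 → ℝ}
    {E : Set (Sym2 V)} (h : LinearIndepOn ℝ (row p') E) : LinearIndepOn ℝ (row p) E := by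
  classical
  let A (q : V → Fin 2 → ℝ) : Matrix E (V × Fin 2) ℝ := Matrix.of fun e => row q e
  let P : Matrix E (V × Fin 2) (MvPolynomial (V × Fin 2) ℚ) := Matrix.of fun e => rowPoly e
  have hPA : ∀ q, evalAt q (P * P.transpose).det = (A q * (A q).transpose).det := by
    intro q
    rw [AlgHom.map_det]
    congr 1
    ext e f
    simp [Matrix.mul_apply, P, A, evalAt_rowPoly]
  have key : ∀ q, LinearIndepOn ℝ (row q) E ↔ (A q * (A q).transpose).det ≠ 0 := by
    intro q
    have h1 : LinearIndepOn ℝ (row q) E ↔ Function.Injective (A q).vecMul := by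
      rw [Matrix.vecMul_injective_iff]; rfl
    rw [h1, ne_eq, ← Matrix.exists_vecMul_eq_zero_iff, not_exists]
    constructor
    · rintro hi v ⟨hv, h0⟩
      apply hv
      apply hi
      have : (A q).vecMul v ⬝ᵥ (A q).vecMul v = 0 := by
        rw [← Matrix.mulVec_transpose, Matrix.dotProduct_mulVec, Matrix.vecMul_transpose,
          Matrix.mulVec_mulVec, ← Matrix.vecMul_transpose, Matrix.transpose_mul,
          Matrix.transpose_transpose, h0, zero_dotProduct]
      simpa using dotProduct_self_eq_zero.1 this
    · intro hn v w hvw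
      by_contra hne
      refine hn (v - w) ⟨sub_ne_zero.2 hne, ?_⟩
      rw [← Matrix.vecMul_vecMul, Matrix.sub_vecMul]
      simp only [] at hvw
      rw [hvw, sub_self, Matrix.zero_vecMul]
  rw [key] at h ⊢
  rw [← hPA] at h ⊢
  exact hp.evalAt_ne_zero p' h

theorem Generic.finrank_le {p : V → Fin 2 → ℝ} (hp : Generic p) (p' : V → Fin 2 → ℝ)
    (E : Set (Sym2 V)) :
    Module.finrank ℝ (rowSpan p' E) ≤ Module.finrank ℝ (rowSpan p E) := by
  obtain ⟨B, -, hBE, -, hspan, hB⟩ : ∃ B : Set (Sym2 V), True ∧ B ⊆ E ∧ True ∧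
      rowSpan p' E ≤ rowSpan p' B ∧ LinearIndepOn ℝ (row p') B := by
    obtain ⟨B, hBE, -, h2, h3⟩ := exists_linearIndepOn_extension (K := ℝ) (v := row p') (s := ∅)
      (t := E) (by simp) (by simp)
    exact ⟨B, trivial, hBE, trivial, Submodule.span_le.2 h2, h3⟩
  have h1 := (linearIndepOn_row_iff _ _).1 hB
  have h2 := (linearIndepOn_row_iff _ _).1 (hp.linearIndepOn hB)
  have h3 := finrank_rowSpan_add p' B
  have h4 := finrank_rowSpan_add p B
  rw [h1, finrank_bot] at h3
  rw [h2, finrank_bot] at h4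
  calc _ ≤ Module.finrank ℝ (rowSpan p' B) := Submodule.finrank_mono hspan
    _ = Module.finrank ℝ (rowSpan p B) := by omega
    _ ≤ _ := Submodule.finrank_mono (rowSpan_mono p hBE)

theorem Generic.stress_eq_bot {p : V → Fin 2 → ℝ} (hp : Generic p) {p' : V → Fin 2 → ℝ}
    {E : Set (Sym2 V)} (h : stress p' E = ⊥) : stress p E = ⊥ :=
  (linearIndepOn_row_iff _ _).1 (hp.linearIndepOn ((linearIndepOn_row_iff _ _).2 h))

theorem Generic.rd_eq {p : V → Fin 2 → ℝ} (hp : Generic p) (E : Set (Sym2 V)) :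
    rd 2 E = Module.finrank ℝ (rowSpan p E) := by
  apply IsGreatest.csSup_eq
  refine ⟨⟨p, (rankAt_eq p E).symm⟩, ?_⟩
  rintro _ ⟨q, rfl⟩
  rw [rankAt_eq]
  exact hp.finrank_le q E

theorem Generic.inCl {p q : V → Fin 2 → ℝ} (hp : Generic p) (hq : Generic q) {E : Set (Sym2 V)}
    {e : Sym2 V} (h : InCl p E e) : InCl q E e := by
  rw [inCl_iff_finrank, ← hp.rd_eq, ← hp.rd_eq] at h
  rwa [inCl_iff_finrank, ← hq.rd_eq, ← hq.rd_eq]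

/-- Three points of a generic placement are not collinear. -/
theorem Generic.det_ne_zero {p : V → Fin 2 → ℝ} (hp : Generic p) {a b c : V} (hab : a ≠ b)
    (hac : a ≠ c) (hbc : b ≠ c) :
    (p b 0 - p a 0) * (p c 1 - p a 1) - (p b 1 - p a 1) * (p c 0 - p a 0) ≠ 0 := by
  let P : MvPolynomial (V × Fin 2) ℚ :=
    (.X (b, 0) - .X (a, 0)) * (.X (c, 1) - .X (a, 1)) - (.X (b, 1) - .X (a, 1)) * (.X (c, 0) - .X (a, 0))
  let p' : V → Fin 2 → ℝ := fun w => if w = b then ![1, 0] else if w = c then ![0, 1] else ![0, 0]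
  have := hp.evalAt_ne_zero p' (P := P) (by simp [P, p', hab, hac, hbc.symm])
  simpa [P] using this

/-- A squared length whose row lies in the span of others is algebraic over the others, with
a relation that persists for all placements sharing those lengths. -/
theorem Generic.exists_polynomial {p : V → Fin 2 → ℝ} (hp : Generic p) {E : Set (Sym2 V)}
    {e : Sym2 V} (h : InCl p E e) :
    ∃ P : Polynomial (Algebra.adjoin ℚ (lenSq p '' E)), P ≠ 0 ∧
      ∀ q : V → Fin 2 → ℝ, (∀ f ∈ E, lenSq q f = lenSq p f) → Polynomial.aeval (lenSq q e) P = 0 := by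
  let A := Algebra.adjoin ℚ (lenSq p '' E)
  let K := IntermediateField.adjoin ℚ (lenSq p '' E)
  have halg : IsAlgebraic K (lenSq p e) := by
    by_contra htr
    obtain ⟨D, hD⟩ := exists_derivation_ne_zero (K := K) (L := ℝ) (g := lenSq p e) htr
    let m : V × Fin 2 → ℝ := fun wi => D (p wi.1 wi.2)
    have hDm : ∀ f, D (lenSq p f) = 2 * (row p f ⬝ᵥ m) := by
      intro f
      induction f with | _ u v =>
      rw [lenSq_mk, row_dotProduct, map_sum, Finset.mul_sum]
      refine Finset.sum_congr rfl fun i _ => ?_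
      rw [Derivation.leibniz_pow]
      simp [m]
    have hE : ∀ x ∈ rowSpan p E, x ⬝ᵥ m = 0 := by
      intro x hx
      induction hx using Submodule.span_induction with
      | mem x hx =>
        obtain ⟨f, hf, rfl⟩ := hx
        have h1 : D (algebraMap K ℝ ⟨lenSq p f, IntermediateField.subset_adjoin _ _ ⟨f, hf, rfl⟩⟩) = 0 :=
          D.map_algebraMap _
        have h2 := hDm f
        rw [show D (lenSq p f) = 0 from h1] at h2
        linarith
      | zero => simp
      | add x y _ _ hx hy => rw [add_dotProduct, hx, hy, add_zero]
      | smul a x _ hx => rw [smul_dotProduct, hx, smul_zero]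
    apply hD
    rw [hDm, hE _ h, mul_zero]
  have halgA : IsAlgebraic A (lenSq p e) := by
    open scoped IntermediateField.algebraAdjoinAdjoin in
    have : IsFractionRing A K := inferInstance
    open scoped IntermediateField.algebraAdjoinAdjoin in
    exact (IsFractionRing.isAlgebraic_iff A K ℝ).2 halg
  obtain ⟨P, hP0, hP⟩ := halgA
  refine ⟨P, hP0, fun q hq => ?_⟩
  let φ : MvPolynomial (E : Set (Sym2 V)) ℚ →ₐ[ℚ] A :=
    MvPolynomial.aeval fun f => ⟨lenSq p f, Algebra.subset_adjoin ⟨f, f.2, rfl⟩⟩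
  have hφv : ∀ x, ((φ x : A) : ℝ) = MvPolynomial.aeval (fun f : E => lenSq p f) x := by
    intro x
    have : A.val.comp φ = MvPolynomial.aeval (fun f : E => lenSq p f) := by
      ext f; simp [φ]
    exact DFunLike.congr_fun this x
  have hφ : Function.Surjective φ := by
    rintro ⟨x, hx⟩
    have hx' := hx
    simp only [A] at hx'
    rw [Set.image_eq_range, Algebra.adjoin_range_eq_range_aeval] at hx'
    obtain ⟨y, hy⟩ := hx'
    exact ⟨y, Subtype.ext ((hφv y).trans hy)⟩
  obtain ⟨Q, hQ⟩ := Polynomial.map_surjective φ.toRingHom hφ P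
  let R : MvPolynomial (V × Fin 2) ℚ :=
    Q.eval₂ (MvPolynomial.aeval fun f : E => lenPoly (f : Sym2 V)).toRingHom (lenPoly e)
  have hR : ∀ r : V → Fin 2 → ℝ, (∀ f ∈ E, lenSq r f = lenSq p f) →
      evalAt r R = Polynomial.aeval (lenSq r e) P := by
    intro r hr
    rw [← hQ, Polynomial.aeval_def, Polynomial.eval₂_map]
    simp only [R]
    change (evalAt r).toRingHom _ = _
    rw [Polynomial.hom_eval₂]
    congr 1
    · have : (evalAt r).comp (MvPolynomial.aeval fun f : E => lenPoly (f : Sym2 V)) =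
          A.val.comp φ := by
        ext f
        simp [φ, aeval_lenPoly, hr f f.2]
      exact congrArg AlgHom.toRingHom this
    · exact aeval_lenPoly r e
  have hR0 : R = 0 := hp.eq_zero (by rw [hR p fun _ _ => rfl]; exact hP)
  rw [← hR q hq, hR0, map_zero]

end

section

variable [Fintype V] [DecidableEq V]

theorem hasStrictFDerivAt_lenSq (e : Sym2 V) (x : V × Fin 2 → ℝ) :
    HasStrictFDerivAt (fun y : V × Fin 2 → ℝ => lenSq (Function.curry y) e)
      (LinearMap.toContinuousLinearMap
        ((2 : ℝ) • (dotProductBilin ℝ ℝ (row (Function.curry x) e) : (V × Fin 2 → ℝ) →ₗ[ℝ] ℝ))) x := by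
  induction e with | _ u v =>
  have h : HasStrictFDerivAt (fun y : V × Fin 2 → ℝ => ∑ i, (y (u, i) - y (v, i)) ^ 2)
      (∑ i : Fin 2, (2 • (x (u, i) - x (v, i)) ^ (2 - 1)) •
        (ContinuousLinearMap.proj (u, i) - ContinuousLinearMap.proj (v, i) :
          (V × Fin 2 → ℝ) →L[ℝ] ℝ)) x :=
    HasStrictFDerivAt.fun_sum fun i _ =>
      HasStrictFDerivAt.pow ((hasStrictFDerivAt_apply (u, i) x).sub (hasStrictFDerivAt_apply (v, i) x)) 2
  refine h.congr_fderiv ?_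
  ext m
  simp [row_dotProduct, mul_assoc, Function.curry]
  ring

theorem continuous_lenSq (e : Sym2 V) :
    Continuous fun y : V × Fin 2 → ℝ => lenSq (Function.curry y) e :=
  continuous_iff_continuousAt.2 fun x => (hasStrictFDerivAt_lenSq e x).continuousAt

/-- Lengths with independent rows can be perturbed arbitrarily. -/
theorem map_nhds_lenSq {I : Set (Sym2 V)} {x : V × Fin 2 → ℝ}
    (hI : LinearIndepOn ℝ (row (Function.curry x)) I) :
    Filter.map (fun (y : V × Fin 2 → ℝ) (e : I) => lenSq (Function.curry y) e) (nhds x) =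
      nhds (fun e : I => lenSq (Function.curry x) e) := by
  classical
  let A : Matrix I (V × Fin 2) ℝ := Matrix.of fun e => row (Function.curry x) e
  let f' : (V × Fin 2 → ℝ) →L[ℝ] (I → ℝ) := LinearMap.toContinuousLinearMap ((2 : ℝ) • A.mulVecLin)
  have hf : HasStrictFDerivAt (fun (y : V × Fin 2 → ℝ) (e : I) => lenSq (Function.curry y) e) f' x := by
    rw [hasStrictFDerivAt_pi']
    intro e
    refine (hasStrictFDerivAt_lenSq (e : Sym2 V) x).congr_fderiv ?_
    ext m
    simp [f', A, Matrix.mulVec, smul_eq_mul]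
  refine hf.map_nhds_eq_of_surj ?_
  have hA : LinearMap.range A.mulVecLin = ⊤ := by
    apply Submodule.eq_top_of_finrank_eq
    have : A.rank = Fintype.card I := LinearIndependent.rank_matrix hI
    rw [Module.finrank_fintype_fun_eq_card, ← this]; rfl
  rw [LinearMap.range_eq_top] at hA ⊢
  intro y
  obtain ⟨z, hz⟩ := hA ((1 / 2 : ℝ) • y)
  refine ⟨z, ?_⟩
  change (2 : ℝ) • A.mulVecLin z = y
  rw [hz, smul_smul]; norm_num

/-- A pair that is globally linked in a generic framework lies in the closure of the edge set. -/
theorem Generic.inCl_of_globallyLinkedIn {p : V → Fin 2 → ℝ} (hp : Generic p) {G : SimpleGraph V}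
    {u v : V} (h : GloballyLinkedIn G p u v) : InCl p G.edgeSet s(u, v) := by
  by_contra hn
  obtain ⟨B, hBE, -, hspan, hB⟩ := exists_linearIndepOn_extension (K := ℝ) (v := row p) (s := ∅)
      (t := G.edgeSet) (by simp) (by simp)
  have hI : LinearIndepOn ℝ (row p) (insert s(u, v) B) :=
    hB.insert fun h' => hn (rowSpan_mono p hBE h')
  let x : V × Fin 2 → ℝ := Function.uncurry p
  let I : Set (Sym2 V) := insert s(u, v) B
  let f : (V × Fin 2 → ℝ) → (I → ℝ) := fun y e => lenSq (Function.curry y) e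
  have hmap : Filter.map f (nhds x) = nhds (f x) := map_nhds_lenSq hI
  have hN : ∀ᶠ y in nhds x, ∀ e ∈ G.edgeSet, (∀ f ∈ B, lenSq (Function.curry y) f = lenSq p f) →
      lenSq (Function.curry y) e = lenSq p e := by
    rw [Filter.eventually_all]
    intro e
    by_cases he : e ∈ G.edgeSet
    swap
    · exact Filter.Eventually.of_forall fun _ h => absurd h he
    obtain ⟨P, hP0, hP⟩ := hp.exists_polynomial (E := B) (e := e) (hspan ⟨e, he, rfl⟩)
    have hfin : (P.rootSet ℝ \ {lenSq p e}).Finite := (Polynomial.rootSet_finite P ℝ).subset Set.sdiff_subset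
    have hnh : (P.rootSet ℝ \ {lenSq p e})ᶜ ∈ nhds (lenSq (Function.curry x) e) :=
      hfin.isClosed.isOpen_compl.mem_nhds (by simp [x])
    filter_upwards [(continuous_lenSq e).continuousAt hnh] with y hy _ hyB
    by_contra hne
    refine hy ⟨?_, hne⟩
    rw [Polynomial.mem_rootSet]
    exact ⟨hP0, hP _ hyB⟩
  have himg : f '' {y | ∀ e ∈ G.edgeSet, (∀ f ∈ B, lenSq (Function.curry y) f = lenSq p f) →
      lenSq (Function.curry y) e = lenSq p e} ∈ nhds (f x) := by
    rw [← hmap]; exact Filter.image_mem_map hN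
  let e0 : I := ⟨s(u, v), Set.mem_insert _ _⟩
  have hline : Filter.Tendsto (fun t : ℝ => f x + Pi.single e0 t) (nhdsWithin 0 {0}ᶜ) (nhds (f x)) := by
    have hc : Continuous (fun t : ℝ => f x + Pi.single e0 t) :=
      continuous_const.add (continuous_single (A := fun _ : I => ℝ) e0)
    have := hc.tendsto 0
    simp only [Pi.single_zero, add_zero] at this
    exact this.mono_left nhdsWithin_le_nhds
  obtain ⟨t, ⟨y, hy, hyt⟩, ht⟩ := ((hline.eventually himg).and self_mem_nhdsWithin).exists
  have hyB : ∀ f ∈ B, lenSq (Function.curry y) f = lenSq p f := by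
    intro g hg
    have hgI : g ∈ I := Set.mem_insert_of_mem _ hg
    have h1 := congrFun hyt ⟨g, hgI⟩
    have hne : (⟨g, hgI⟩ : I) ≠ e0 := by
      intro h0
      have h1 : g = s(u, v) := congrArg Subtype.val h0
      exact hn (h1 ▸ row_mem_rowSpan p (hBE hg))
    rw [Pi.add_apply, Pi.single_eq_of_ne hne, add_zero] at h1
    exact h1
  have heq := h (Function.curry y) ((equivalent_iff _ _ _).2 fun e he => hy e he hyB)
  rw [eDist_eq_iff] at heq
  have h2 := congrFun hyt e0
  rw [Pi.add_apply, Pi.single_eq_same] at h2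
  have h3 : lenSq (Function.curry y) s(u, v) = lenSq p s(u, v) + t := h2
  rw [heq] at h3
  exact ht (by simpa using h3)

end

section

variable [Fintype V] [DecidableEq V]

/-- If the Gram identity of three planar vectors `r, b, c`, in which `r` enters only through its
distances, persists for all positions in the plane, then `|b|` is determined. -/
theorem eq_of_gram_identity {B₀ B₁ C₀ C₁ bb cc dd : ℝ} (hdet : B₀ * C₁ - B₁ * C₀ ≠ 0)
    (hbb : bb ≠ 0)
    (h : ∀ P₀ P₁ : ℝ, (P₀ ^ 2 + P₁ ^ 2) * (4 * bb * cc - (bb + cc - dd) ^ 2) =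
      cc * (2 * (P₀ * B₀ + P₁ * B₁) + (bb - (B₀ ^ 2 + B₁ ^ 2))) ^ 2
      - (bb + cc - dd) * (2 * (P₀ * B₀ + P₁ * B₁) + (bb - (B₀ ^ 2 + B₁ ^ 2))) *
        (2 * (P₀ * C₀ + P₁ * C₁) + (cc - (C₀ ^ 2 + C₁ ^ 2)))
      + bb * (2 * (P₀ * C₀ + P₁ * C₁) + (cc - (C₀ ^ 2 + C₁ ^ 2))) ^ 2) :
    bb = B₀ ^ 2 + B₁ ^ 2 := by
  have hsolve : ∀ s t : ℝ, ∃ P₀ P₁ : ℝ,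
      2 * (P₀ * B₀ + P₁ * B₁) + (bb - (B₀ ^ 2 + B₁ ^ 2)) = s ∧
      2 * (P₀ * C₀ + P₁ * C₁) + (cc - (C₀ ^ 2 + C₁ ^ 2)) = t := by
    intro s t
    refine ⟨((s - (bb - (B₀ ^ 2 + B₁ ^ 2))) / 2 * C₁ - (t - (cc - (C₀ ^ 2 + C₁ ^ 2))) / 2 * B₁) /
        (B₀ * C₁ - B₁ * C₀),
      ((t - (cc - (C₀ ^ 2 + C₁ ^ 2))) / 2 * B₀ - (s - (bb - (B₀ ^ 2 + B₁ ^ 2))) / 2 * C₀) /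
        (B₀ * C₁ - B₁ * C₀), ?_, ?_⟩
    · field_simp
      ring
    · field_simp
      ring
  by_cases hΔ : 4 * bb * cc - (bb + cc - dd) ^ 2 = 0
  · obtain ⟨P₀, P₁, hs, ht⟩ := hsolve 0 1
    have := h P₀ P₁
    rw [hs, ht, hΔ] at this
    exact absurd (by linarith) hbb
  · obtain ⟨P₀, P₁, hs, ht⟩ := hsolve 0 0
    have h1 := h P₀ P₁
    rw [hs, ht] at h1
    have h2 : P₀ ^ 2 + P₁ ^ 2 = 0 := by
      refine (mul_eq_zero.1 ?_).resolve_right hΔ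
      linarith
    have h3 : P₀ = 0 := by nlinarith [sq_nonneg P₀, sq_nonneg P₁]
    have h4 : P₁ = 0 := by nlinarith [sq_nonneg P₀, sq_nonneg P₁]
    subst h3; subst h4
    linarith

/-- A Gram identity at an algebraically independent point holds everywhere. -/
theorem gram_identity_of_algebraicIndependent {K : Type*} [CommRing K] [Algebra K ℝ]
    {r : Fin 2 → ℝ} (hr : AlgebraicIndependent K r) (X B C : Fin 2 → K) (bb cc dd : K)
    {G : ℝ → ℝ → ℝ}
    (hG : ∀ P₀ P₁ : ℝ, G P₀ P₁ = (P₀ ^ 2 + P₁ ^ 2) *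
        (4 * algebraMap K ℝ bb * algebraMap K ℝ cc -
          (algebraMap K ℝ bb + algebraMap K ℝ cc - algebraMap K ℝ dd) ^ 2) -
      (algebraMap K ℝ cc * (2 * (P₀ * algebraMap K ℝ (B 0) + P₁ * algebraMap K ℝ (B 1)) +
        (algebraMap K ℝ bb - (algebraMap K ℝ (B 0) ^ 2 + algebraMap K ℝ (B 1) ^ 2))) ^ 2
      - (algebraMap K ℝ bb + algebraMap K ℝ cc - algebraMap K ℝ dd) *
        (2 * (P₀ * algebraMap K ℝ (B 0) + P₁ * algebraMap K ℝ (B 1)) +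
        (algebraMap K ℝ bb - (algebraMap K ℝ (B 0) ^ 2 + algebraMap K ℝ (B 1) ^ 2))) *
        (2 * (P₀ * algebraMap K ℝ (C 0) + P₁ * algebraMap K ℝ (C 1)) +
        (algebraMap K ℝ cc - (algebraMap K ℝ (C 0) ^ 2 + algebraMap K ℝ (C 1) ^ 2)))
      + algebraMap K ℝ bb * (2 * (P₀ * algebraMap K ℝ (C 0) + P₁ * algebraMap K ℝ (C 1)) +
        (algebraMap K ℝ cc - (algebraMap K ℝ (C 0) ^ 2 + algebraMap K ℝ (C 1) ^ 2))) ^ 2))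
    (h0 : G (r 0 - algebraMap K ℝ (X 0)) (r 1 - algebraMap K ℝ (X 1)) = 0) (P₀ P₁ : ℝ) :
    G P₀ P₁ = 0 := by
  let c : K → MvPolynomial (Fin 2) K := MvPolynomial.C
  let p₀ : MvPolynomial (Fin 2) K := .X 0 - c (X 0)
  let p₁ : MvPolynomial (Fin 2) K := .X 1 - c (X 1)
  let s := 2 * (p₀ * c (B 0) + p₁ * c (B 1)) + (c bb - (c (B 0) ^ 2 + c (B 1) ^ 2))
  let t := 2 * (p₀ * c (C 0) + p₁ * c (C 1)) + (c cc - (c (C 0) ^ 2 + c (C 1) ^ 2))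
  let R : MvPolynomial (Fin 2) K := (p₀ ^ 2 + p₁ ^ 2) * (4 * c bb * c cc - (c bb + c cc - c dd) ^ 2) -
    (c cc * s ^ 2 - (c bb + c cc - c dd) * s * t + c bb * t ^ 2)
  have heval : ∀ r : Fin 2 → ℝ, MvPolynomial.aeval r R =
      G (r 0 - algebraMap K ℝ (X 0)) (r 1 - algebraMap K ℝ (X 1)) := by
    intro r
    rw [hG]
    simp [R, p₀, p₁, s, t, c]
  have hR : R = 0 := algebraicIndependent_iff.1 hr R (by rw [heval, h0])
  have := heval ![P₀ + algebraMap K ℝ (X 0), P₁ + algebraMap K ℝ (X 1)]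
  rw [hR, map_zero] at this
  simpa using this.symm

theorem evalAt_lenPoly (q : V → Fin 2 → ℝ) (e : Sym2 V) : evalAt q (lenPoly e) = lenSq q e :=
  aeval_lenPoly q e

/-- If a generic framework has a vertex `v` joined to `x, y, z` and the lengths of `xy, yz, xz`
are locally determined by edges avoiding `v`, then the length of `xy` is globally determined. -/
theorem Generic.lenSq_eq_of_star {p : V → Fin 2 → ℝ} (hp : Generic p) {E : Set (Sym2 V)}
    {v x y z : V} (hE : ∀ e ∈ E, v ∉ e) (hvx : v ≠ x) (hvy : v ≠ y) (hvz : v ≠ z) (hxy : x ≠ y)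
    (hxz : x ≠ z) (hyz : y ≠ z) (h₁ : InCl p E s(x, y)) (h₂ : InCl p E s(y, z))
    (h₃ : InCl p E s(x, z)) {q : V → Fin 2 → ℝ} (hq : ∀ e ∈ E, lenSq q e = lenSq p e)
    (hqx : lenSq q s(v, x) = lenSq p s(v, x)) (hqy : lenSq q s(v, y) = lenSq p s(v, y))
    (hqz : lenSq q s(v, z) = lenSq p s(v, z)) : lenSq q s(x, y) = lenSq p s(x, y) := by
  let S : Set (V × Fin 2) := {wi | wi.1 ≠ v}
  let c : V × Fin 2 → ℝ := fun wi => p wi.1 wi.2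
  let A := Algebra.adjoin ℚ (c '' S)
  let K := Subalgebra.algebraicClosure A ℝ
  have hind : AlgebraicIndependent K (fun i : Fin 2 => p v i) := by
    have hS : Disjoint S {wi | wi.1 = v} := by
      rw [Set.disjoint_left]; intro wi h1 h2; exact h1 h2
    have h1 : AlgebraicIndependent A (fun i : {wi : V × Fin 2 | wi.1 = v} => c i) :=
      AlgebraicIndependent.adjoin_of_disjoint hp hS
    have h2 := h1.subalgebraAlgebraicClosure
    exact h2.comp (fun i : Fin 2 => (⟨(v, i), rfl⟩ : {wi : V × Fin 2 | wi.1 = v}))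
      (fun i j hij => by simpa using hij)
  have hcA : ∀ w i, w ≠ v → p w i ∈ A := fun w i hw => Algebra.subset_adjoin ⟨(w, i), hw, rfl⟩
  have hcK : ∀ w i, w ≠ v → p w i ∈ K := fun w i hw =>
    (Subalgebra.mem_algebraicClosure _ _).2 (isAlgebraic_algebraMap (⟨p w i, hcA w i hw⟩ : A))
  have hlen : Algebra.adjoin ℚ (lenSq p '' E) ≤ A := by
    refine Algebra.adjoin_le ?_
    rintro _ ⟨e, he, rfl⟩
    have hve := hE e he
    induction e with | _ a b =>
    rw [Sym2.mem_iff, not_or] at hve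
    rw [lenSq_mk]
    exact Subalgebra.sum_mem _ fun i _ => Subalgebra.pow_mem _ (Subalgebra.sub_mem _
      (hcA a i (Ne.symm hve.1)) (hcA b i (Ne.symm hve.2))) 2
  have hK : ∀ e, InCl p E e → lenSq q e ∈ K := by
    intro e he
    obtain ⟨P, hP0, hP⟩ := hp.exists_polynomial he
    refine (Subalgebra.mem_algebraicClosure _ _).2
      ⟨P.map (Subalgebra.inclusion hlen).toRingHom, ?_, ?_⟩
    · rwa [Polynomial.map_ne_zero_iff]
      exact Subalgebra.inclusion_injective hlen
    · have := hP q hq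
      rw [Polynomial.aeval_def] at this ⊢
      rw [Polynomial.eval₂_map]
      exact this
  have hne : lenSq q s(x, y) ≠ 0 := by
    intro h0
    have h00 : ∀ i, q x i = q y i := by
      rw [lenSq_mk, Finset.sum_eq_zero_iff_of_nonneg fun _ _ => sq_nonneg _] at h0
      intro i
      have := h0 i (Finset.mem_univ i)
      exact sub_eq_zero.1 (pow_eq_zero_iff two_ne_zero |>.1 this)
    have h1 : lenSq q s(v, x) = lenSq q s(v, y) := by simp [lenSq_mk, h00]
    rw [hqx, hqy, ← sub_eq_zero, ← aeval_lenPoly, ← aeval_lenPoly, ← map_sub] at h1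
    refine hp.evalAt_ne_zero (fun w _ => if w = x then 1 else 0) ?_ h1
    rw [map_sub, evalAt_lenPoly, evalAt_lenPoly]
    simp [lenSq_mk, hvx, hxy.symm]
  let k (w : V) (hw : v ≠ w) (i : Fin 2) : K := ⟨p w i, hcK w i hw.symm⟩
  have hid := gram_identity_of_algebraicIndependent hind (k x hvx)
    (fun i => k y hvy i - k x hvx i) (fun i => k z hvz i - k x hvx i)
    ⟨_, hK _ h₁⟩ ⟨_, hK _ h₃⟩ ⟨_, hK _ h₂⟩ (fun _ _ => rfl) (by
      simp only [map_sub]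
      change ((p v 0 - p x 0) ^ 2 + (p v 1 - p x 1) ^ 2) * (4 * lenSq q s(x, y) * lenSq q s(x, z) -
        (lenSq q s(x, y) + lenSq q s(x, z) - lenSq q s(y, z)) ^ 2) -
        (lenSq q s(x, z) * (2 * ((p v 0 - p x 0) * (p y 0 - p x 0) + (p v 1 - p x 1) * (p y 1 - p x 1)) +
          (lenSq q s(x, y) - ((p y 0 - p x 0) ^ 2 + (p y 1 - p x 1) ^ 2))) ^ 2 -
        (lenSq q s(x, y) + lenSq q s(x, z) - lenSq q s(y, z)) *
        (2 * ((p v 0 - p x 0) * (p y 0 - p x 0) + (p v 1 - p x 1) * (p y 1 - p x 1)) +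
          (lenSq q s(x, y) - ((p y 0 - p x 0) ^ 2 + (p y 1 - p x 1) ^ 2))) *
        (2 * ((p v 0 - p x 0) * (p z 0 - p x 0) + (p v 1 - p x 1) * (p z 1 - p x 1)) +
          (lenSq q s(x, z) - ((p z 0 - p x 0) ^ 2 + (p z 1 - p x 1) ^ 2))) +
        lenSq q s(x, y) * (2 * ((p v 0 - p x 0) * (p z 0 - p x 0) + (p v 1 - p x 1) * (p z 1 - p x 1)) +
          (lenSq q s(x, z) - ((p z 0 - p x 0) ^ 2 + (p z 1 - p x 1) ^ 2))) ^ 2) = 0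
      simp only [lenSq_mk, Fin.sum_univ_two] at hqx hqy hqz ⊢
      have e1 : 2 * ((p v 0 - p x 0) * (p y 0 - p x 0) + (p v 1 - p x 1) * (p y 1 - p x 1)) +
          ((q x 0 - q y 0) ^ 2 + (q x 1 - q y 1) ^ 2 - ((p y 0 - p x 0) ^ 2 + (p y 1 - p x 1) ^ 2)) =
          2 * ((q v 0 - q x 0) * (q y 0 - q x 0) + (q v 1 - q x 1) * (q y 1 - q x 1)) := by
        linear_combination hqy - hqx
      have e2 : 2 * ((p v 0 - p x 0) * (p z 0 - p x 0) + (p v 1 - p x 1) * (p z 1 - p x 1)) +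
          ((q x 0 - q z 0) ^ 2 + (q x 1 - q z 1) ^ 2 - ((p z 0 - p x 0) ^ 2 + (p z 1 - p x 1) ^ 2)) =
          2 * ((q v 0 - q x 0) * (q z 0 - q x 0) + (q v 1 - q x 1) * (q z 1 - q x 1)) := by
        linear_combination hqz - hqx
      rw [e1, e2, ← hqx]
      ring)
  have key := eq_of_gram_identity (B₀ := p y 0 - p x 0) (B₁ := p y 1 - p x 1) (C₀ := p z 0 - p x 0)
    (C₁ := p z 1 - p x 1) (bb := lenSq q s(x, y)) (cc := lenSq q s(x, z)) (dd := lenSq q s(y, z))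
    (hp.det_ne_zero hxy hxz hyz) hne (fun r₀ r₁ => sub_eq_zero.1 (hid r₀ r₁))
  rw [key, lenSq_mk, Fin.sum_univ_two]
  ring

end

section

variable [Fintype V] [DecidableEq V]

/-- The pairs of distinct elements of a set. -/
def pairs (S : Set V) : Set (Sym2 V) := {e | ¬ e.IsDiag ∧ ∀ w ∈ e, w ∈ S}

theorem mk_mem_pairs {S : Set V} {a b : V} : s(a, b) ∈ pairs S ↔ a ≠ b ∧ a ∈ S ∧ b ∈ S := by
  simp [pairs]

theorem pairs_mono {S T : Set V} (h : S ⊆ T) : pairs S ⊆ pairs T :=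
  fun _ he => ⟨he.1, fun w hw => h (he.2 w hw)⟩

theorem pairs_inter (S T : Set V) : pairs (S ∩ T) = pairs S ∩ pairs T := by
  ext e
  simp only [pairs, Set.mem_ofPred_eq, Set.mem_inter_iff]
  grind

theorem ncard_pairs (S : Set V) : (pairs S).ncard = S.ncard.choose 2 := by
  classical
  rw [Set.ncard_eq_toFinset_card' S, ← Sym2.card_image_offDiag, ← Set.ncard_coe_finset]
  congr 1
  ext e
  induction e with | _ a b =>
  rw [mk_mem_pairs]
  simp only [Finset.coe_image, Set.mem_image, Finset.mem_coe, Finset.mem_offDiag, Set.mem_toFinset,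
    Prod.exists]
  constructor
  · rintro ⟨h1, h2, h3⟩
    exact ⟨a, b, ⟨h2, h3, h1⟩, rfl⟩
  · rintro ⟨c, d, ⟨h2, h3, h1⟩, h⟩
    rcases Sym2.eq_iff.1 h with ⟨rfl, rfl⟩ | ⟨rfl, rfl⟩
    · exact ⟨h1, h2, h3⟩
    · exact ⟨h1.symm, h3, h2⟩

/-- The force at a vertex all of whose stressed edges go to `x, y, z`. -/
theorem forceMap_star (p : V → Fin 2 → ℝ) {ω : Sym2 V → ℝ} {v x y z : V} (hxy : x ≠ y)
    (hxz : x ≠ z) (hyz : y ≠ z) (h : ∀ w, w ≠ x → w ≠ y → w ≠ z → ω s(v, w) = 0) (i : Fin 2) :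
    forceMap p ω (v, i) = ω s(v, x) * (p v i - p x i) + ω s(v, y) * (p v i - p y i) +
      ω s(v, z) * (p v i - p z i) := by
  rw [forceMap_apply, ← Finset.sum_subset (Finset.subset_univ {x, y, z})]
  · rw [Finset.sum_insert (by simp [hxy, hxz]), Finset.sum_pair hyz, add_assoc]
  · intro w _ hw
    simp only [Finset.mem_insert, Finset.mem_singleton, not_or] at hw
    rw [h w hw.1 hw.2.1 hw.2.2, zero_mul]

theorem forceMap_congr {p p' : V → Fin 2 → ℝ} {ω : Sym2 V → ℝ} {v : V} (hp : ∀ w, w ≠ v → p w = p' w)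
    (hω : ∀ e, v ∈ e → ω e = 0) : forceMap p ω = forceMap p' ω := by
  ext ⟨w, i⟩
  rw [forceMap_apply, forceMap_apply]
  refine Finset.sum_congr rfl fun u _ => ?_
  by_cases hw : w = v
  · rw [hω _ (by simp [hw])]; simp
  by_cases hu : u = v
  · rw [hω _ (by simp [hu])]; simp
  rw [hp w hw, hp u hu]

/-- Subdividing an edge and joining the new vertex to a third one preserves independence. -/
theorem Generic.stress_eq_bot_of_star {p : V → Fin 2 → ℝ} (hp : Generic p) {E : Set (Sym2 V)}
    {v x y z : V} (hE : ∀ e ∈ E, v ∉ e) (hvx : v ≠ x) (hvy : v ≠ y) (hvz : v ≠ z) (hxy : x ≠ y)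
    (hxz : x ≠ z) (hyz : y ≠ z) (hxyE : s(x, y) ∉ E) (h : stress p (insert s(x, y) E) = ⊥) :
    stress p (E ∪ {s(v, x), s(v, y), s(v, z)}) = ⊥ := by
  let p' : V → Fin 2 → ℝ := Function.update p v fun i => (p x i + p y i) / 2
  have hp'v : ∀ i, p' v i = (p x i + p y i) / 2 := fun i => by simp [p']
  have hp' : ∀ w, w ≠ v → p w = p' w := fun w hw => by simp [p', hw]
  refine hp.stress_eq_bot (p' := p') ((Submodule.eq_bot_iff _).2 fun ω hω => ?_)
  have hstar : ∀ w, w ≠ x → w ≠ y → w ≠ z → ω s(v, w) = 0 := by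
    intro w h1 h2 h3
    refine hω.2 _ ?_
    rintro (h | h)
    · exact hE _ h (by simp)
    · simp only [Set.mem_insert_iff, Set.mem_singleton_iff, Sym2.eq_iff] at h
      grind
  have hf : ∀ i, forceMap p' ω (v, i) = 0 := fun i => by
    rw [show forceMap p' ω = 0 from hω.1]; rfl
  have h0 := hf 0
  have h1 := hf 1
  rw [forceMap_star p' hxy hxz hyz hstar, ← hp' x hvx.symm, ← hp' y hvy.symm, ← hp' z hvz.symm, hp'v]
    at h0 h1
  have hdet := hp.det_ne_zero hxy hxz hyz
  set α := ω s(v, x)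
  set β := ω s(v, y)
  set γ := ω s(v, z)
  have hγ : γ = 0 := by
    have : γ * ((p y 0 - p x 0) * (p z 1 - p x 1) - (p y 1 - p x 1) * (p z 0 - p x 0)) = 0 := by
      linear_combination (p y 1 - p x 1) * h0 - (p y 0 - p x 0) * h1
    exact (mul_eq_zero.1 this).resolve_right hdet
  have hαβ : α = β := by
    by_contra hne
    have hne' : (α - β) / 2 ≠ 0 := div_ne_zero (sub_ne_zero.2 hne) two_ne_zero
    have e0 : (α - β) / 2 * (p y 0 - p x 0) = 0 := by rw [hγ] at h0; linear_combination h0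
    have e1 : (α - β) / 2 * (p y 1 - p x 1) = 0 := by rw [hγ] at h1; linear_combination h1
    apply hdet
    rw [(mul_eq_zero.1 e0).resolve_left hne', (mul_eq_zero.1 e1).resolve_left hne']
    ring
  let η : Sym2 V → ℝ := ω - α • (Pi.single s(v, x) 1 + Pi.single s(v, y) 1) +
    (α / 2) • Pi.single s(x, y) 1
  have hxy1 : s(v, x) ≠ s(v, y) := by simp [hxy, hvy]
  have hxy2 : s(v, x) ≠ s(x, y) := by simp [hvx, hvy]
  have hxy3 : s(v, y) ≠ s(x, y) := by simp [hvx, hvy]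
  have hxy4 : s(v, z) ≠ s(x, y) := by simp [hvx, hvy]
  have hxy5 : s(v, z) ≠ s(v, x) := by simp [hxz.symm, hvx]
  have hxy6 : s(v, z) ≠ s(v, y) := by simp [hyz.symm, hvy]
  have hηE : ∀ e, e ∉ insert s(x, y) E → η e = 0 := by
    intro e he
    rw [Set.mem_insert_iff, not_or] at he
    by_cases h1 : e = s(v, x)
    · subst h1; simp [η, α, he.1, hxy1]
    by_cases h2 : e = s(v, y)
    · subst h2; simp [η, hαβ, β, he.1, hxy1.symm]
    have h3 : ω e = 0 := by
      by_cases h3 : e = s(v, z)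
      · subst h3; exact hγ
      · exact hω.2 e (by simp [h1, h2, h3, he.2])
    simp [η, h1, h2, h3, he.1]
  have hηv : ∀ e, v ∈ e → η e = 0 := by
    intro e he
    refine hηE e ?_
    rintro (rfl | h)
    · simp [hvx, hvy] at he
    · exact hE e h he
  have hrow : forceMap p' η = 0 := by
    simp only [η, map_add, map_sub, map_smul, show forceMap p' ω = 0 from hω.1]
    change 0 - α • (row p' s(v, x) + row p' s(v, y)) + (α / 2) • row p' s(x, y) = 0
    rw [row_mk, row_mk, row_mk]
    ext ⟨w, i⟩
    simp only [Pi.add_apply, Pi.sub_apply, Pi.smul_apply, Pi.zero_apply, smul_eq_mul, edgeVec, hp'v,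
      ← hp' x hvx.symm, ← hp' y hvy.symm]
    by_cases hwv : w = v
    · simp only [hwv, hvx, hvy, if_true, if_false]; ring
    by_cases hwx : w = x
    · simp only [hwx, hvx.symm, hxy, if_true, if_false]; ring
    by_cases hwy : w = y
    · simp only [hwy, hvy.symm, hxy.symm, if_true, if_false]; ring
    simp [hwv, hwx, hwy]
  have hη0 : η = 0 := by
    have : η ∈ stress p (insert s(x, y) E) := ⟨by
      change forceMap p η = 0
      rw [forceMap_congr hp' hηv, hrow], hηE⟩
    rwa [h, Submodule.mem_bot] at this
  have hα : α = 0 := by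
    have h1 := congrFun hη0 s(x, y)
    have h2 : ω s(x, y) = 0 := hω.2 _ (by simp [hxyE, hxy2.symm, hxy3.symm, hxy4.symm])
    simp [η, h2, hxy2.symm, hxy3.symm] at h1
    exact h1
  simpa [η, hα] using hη0

/-- The stress of a complete graph induced by an affine dependency. -/
def affineStress (μ : V → ℝ) (e : Sym2 V) : ℝ :=
  open Classical in if e.IsDiag then 0 else Sym2.lift ⟨fun a b => μ a * μ b, fun _ _ => mul_comm _ _⟩ e

theorem affineStress_mk (μ : V → ℝ) {a b : V} (h : a ≠ b) : affineStress μ s(a, b) = μ a * μ b := by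
  simp [affineStress, h]

theorem affineStress_mem {p : V → Fin 2 → ℝ} {μ : V → ℝ} {S : Set V} (hS : ∀ w ∉ S, μ w = 0)
    (h0 : ∑ w, μ w = 0) (hp : ∀ i, ∑ w, μ w * p w i = 0) :
    affineStress μ ∈ stress p (pairs S) := by
  constructor
  · change forceMap p _ = 0
    ext ⟨u, i⟩
    rw [forceMap_apply]
    have : ∀ w, affineStress μ s(u, w) * (p u i - p w i) =
        μ u * p u i * μ w - μ u * (μ w * p w i) := by
      intro w
      by_cases h : u = w
      · subst h; ring
      · rw [affineStress_mk μ h]; ring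
    rw [Finset.sum_congr rfl fun w _ => this w, Finset.sum_sub_distrib, ← Finset.mul_sum,
      ← Finset.mul_sum, h0, hp]
    simp
  · intro e he
    induction e with | _ a b =>
    by_cases hab : a = b
    · simp [affineStress, hab]
    · rw [affineStress_mk μ hab]
      rw [mk_mem_pairs] at he
      by_cases ha : a ∈ S
      · rw [hS b (by tauto), mul_zero]
      · rw [hS a ha, zero_mul]

/-- In the plane each edge of a generic complete graph on four vertices is spanned by the rest. -/
theorem Generic.inCl_four {p : V → Fin 2 → ℝ} (hp : Generic p) {a b x y : V} (hab : a ≠ b)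
    (hax : a ≠ x) (hay : a ≠ y) (hbx : b ≠ x) (hby : b ≠ y) (hxy : x ≠ y) {E : Set (Sym2 V)}
    (h₁ : s(a, b) ∈ E) (h₂ : s(a, x) ∈ E) (h₃ : s(a, y) ∈ E) (h₄ : s(b, x) ∈ E) (h₅ : s(b, y) ∈ E) :
    InCl p E s(x, y) := by
  let det (r s t : V) := (p s 0 - p r 0) * (p t 1 - p r 1) - (p s 1 - p r 1) * (p t 0 - p r 0)
  let μ : V → ℝ := fun w => if w = a then det b x y else if w = b then - det a x y else
    if w = x then det a b y else if w = y then - det a b x else 0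
  have hsum : ∀ f : V → ℝ, ∑ w, μ w * f w = det b x y * f a - det a x y * f b + det a b y * f x
      - det a b x * f y := by
    intro f
    rw [← Finset.sum_subset (Finset.subset_univ {a, b, x, y})]
    · rw [Finset.sum_insert (by simp [hab, hax, hay]), Finset.sum_insert (by simp [hbx, hby]),
        Finset.sum_pair hxy]
      simp [μ, hab.symm, hax.symm, hay.symm, hbx.symm, hby.symm, hxy.symm]
      ring
    · intro w _ hw
      simp only [Finset.mem_insert, Finset.mem_singleton, not_or] at hw
      simp [μ, hw]
  have hst : affineStress μ ∈ stress p (pairs {a, b, x, y}) := by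
    refine affineStress_mem ?_ ?_ ?_
    · intro w hw
      simp only [Set.mem_insert_iff, Set.mem_singleton_iff, not_or] at hw
      simp [μ, hw]
    · have := hsum fun _ => 1
      simp only [mul_one] at this
      rw [this]; simp only [det]; ring
    · intro i
      rw [hsum fun w => p w i]
      simp only [det]
      fin_cases i <;> simp <;> ring
  refine inCl_of_stress hst.1 (e := s(x, y)) ?_ ?_
  · rw [affineStress_mk μ hxy]
    simp only [μ, hax.symm, hay.symm, hbx.symm, hby.symm, hxy.symm, if_true, if_false]
    exact mul_ne_zero (hp.det_ne_zero hab hay hby) (neg_ne_zero.2 (hp.det_ne_zero hab hax hbx))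
  · intro f hf hω
    have hmem : f ∈ pairs ({a, b, x, y} : Set V) := by
      by_contra h; exact hω (hst.2 f h)
    induction f with | _ c d =>
    rw [mk_mem_pairs] at hmem
    simp only [Set.mem_insert_iff, Set.mem_singleton_iff] at hmem
    have hs : ∀ c d : V, s(c, d) = s(d, c) := fun c d => Sym2.eq_swap
    obtain ⟨hcd, rfl | rfl | rfl | rfl, rfl | rfl | rfl | rfl⟩ := hmem <;>
    first
    | exact absurd rfl hcd
    | exact absurd rfl hf
    | exact absurd (hs _ _) hf
    | assumption
    | (rw [hs]; assumption)

end

section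

variable [Fintype V] [DecidableEq V]

theorem Generic.sub_ne_zero {p : V → Fin 2 → ℝ} (hp : Generic p) {a b : V} (hab : a ≠ b) (i : Fin 2) :
    p a i - p b i ≠ 0 := by
  refine _root_.sub_ne_zero.2 fun h => hab ?_
  have := AlgebraicIndependent.injective hp (a₁ := (a, i)) (a₂ := (b, i)) h
  exact congrArg Prod.fst this

theorem Generic.eq_zero_of_star_one {p : V → Fin 2 → ℝ} (hp : Generic p) {ω : Sym2 V → ℝ}
    (hω : forceMap p ω = 0) {v a : V} (hva : v ≠ a) (h : ∀ w, w ≠ v → w ≠ a → ω s(v, w) = 0) :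
    ω s(v, a) = 0 := by
  have h0 := congrFun hω (v, 0)
  rw [forceMap_apply, Finset.sum_eq_single a] at h0
  · exact (mul_eq_zero.1 h0).resolve_right (hp.sub_ne_zero hva 0)
  · intro w _ hw
    by_cases hwv : w = v
    · simp [hwv]
    · rw [h w hwv hw, zero_mul]
  · simp

theorem Generic.eq_zero_of_star_two {p : V → Fin 2 → ℝ} (hp : Generic p) {ω : Sym2 V → ℝ}
    (hω : forceMap p ω = 0) {v a b : V} (hva : v ≠ a) (hvb : v ≠ b) (hab : a ≠ b)
    (h : ∀ w, w ≠ v → w ≠ a → w ≠ b → ω s(v, w) = 0) : ω s(v, a) = 0 ∧ ω s(v, b) = 0 := by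
  have hf : ∀ i, ω s(v, a) * (p v i - p a i) + ω s(v, b) * (p v i - p b i) = 0 := by
    intro i
    have h0 := congrFun hω (v, i)
    rw [forceMap_apply, ← Finset.sum_subset (Finset.subset_univ {a, b}), Finset.sum_pair hab] at h0
    · exact h0
    · intro w _ hw
      simp only [Finset.mem_insert, Finset.mem_singleton, not_or] at hw
      by_cases hwv : w = v
      · simp [hwv]
      · rw [h w hwv hw.1 hw.2, zero_mul]
  have hdet := hp.det_ne_zero hva hvb hab
  have h0 := hf 0
  have h1 := hf 1
  constructor
  · refine (mul_eq_zero.1 (?_ : ω s(v, a) * _ = 0)).resolve_right hdet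
    linear_combination -(p b 1 - p v 1) * h0 + (p b 0 - p v 0) * h1
  · refine (mul_eq_zero.1 (?_ : ω s(v, b) * _ = 0)).resolve_right hdet
    linear_combination (p a 1 - p v 1) * h0 - (p a 0 - p v 0) * h1

theorem rowSpan_le {p : V → Fin 2 → ℝ} {E E' : Set (Sym2 V)} (h : ∀ e ∈ E, InCl p E' e) :
    rowSpan p E ≤ rowSpan p E' := fun _ hx => by
  refine (Submodule.span_le.2 ?_ : rowSpan p E ≤ _) hx
  rintro _ ⟨f, hf, rfl⟩
  exact h f hf

theorem Generic.finrank_rowSpan_pairs {p : V → Fin 2 → ℝ} (hp : Generic p) (n : ℕ) (U : Set V)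
    (hU : U.ncard = n + 2) : Module.finrank ℝ (rowSpan p (pairs U)) = 2 * n + 1 := by
  induction n generalizing U with
  | zero =>
    obtain ⟨a, b, hab, rfl⟩ := Set.ncard_eq_two.1 hU
    have h := finrank_rowSpan_add p (pairs {a, b})
    have hs : stress p (pairs {a, b}) = ⊥ := by
      refine (Submodule.eq_bot_iff _).2 fun ω hω => ?_
      have : ω s(a, b) = 0 := by
        refine hp.eq_zero_of_star_one hω.1 hab fun w h1 h2 => hω.2 _ ?_
        rw [mk_mem_pairs]
        simp [h1, h2]
      ext e
      by_cases he : e ∈ pairs {a, b}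
      · induction e with | _ c d =>
        rw [mk_mem_pairs] at he
        simp only [Set.mem_insert_iff, Set.mem_singleton_iff] at he
        obtain ⟨hcd, rfl | rfl, rfl | rfl⟩ := he
        · exact absurd rfl hcd
        · exact this
        · rw [Sym2.eq_swap]; exact this
        · exact absurd rfl hcd
      · exact hω.2 e he
    rw [hs, finrank_bot, ncard_pairs, hU] at h
    simpa using h
  | succ n ih =>
    obtain ⟨v, hv⟩ : U.Nonempty := Set.nonempty_of_ncard_ne_zero (by omega)
    have hU' : (U \ {v}).ncard = n + 2 := by
      rw [Set.ncard_sdiff_singleton_of_mem hv]; omega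
    obtain ⟨a, b, ha, hb, hab⟩ := (Set.one_lt_ncard_iff (Set.toFinite _)).1
      (show 1 < (U \ {v}).ncard by omega)
    have hva : v ≠ a := fun h => ha.2 h.symm
    have hvb : v ≠ b := fun h => hb.2 h.symm
    let E := pairs (U \ {v}) ∪ {s(v, a), s(v, b)}
    have hspan : rowSpan p (pairs U) = rowSpan p E := by
      apply le_antisymm
      · refine rowSpan_le fun e he => ?_
        have key : ∀ c ∈ U, c ≠ v → InCl p E s(v, c) := by
          intro c hc hcv
          by_cases hca : c = a
          · exact row_mem_rowSpan p (by simp [E, hca])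
          by_cases hcb : c = b
          · exact row_mem_rowSpan p (by simp [E, hcb])
          have hm : ∀ x ∈ U \ {v}, ∀ y ∈ U \ {v}, x ≠ y → s(x, y) ∈ E := fun x hx y hy hxy =>
            Or.inl (mk_mem_pairs.2 ⟨hxy, hx, hy⟩)
          refine hp.inCl_four hab hva.symm (Ne.symm hca) hvb.symm (Ne.symm hcb) (Ne.symm hcv)
            (hm a ha b hb hab) ?_ (hm a ha c ⟨hc, hcv⟩ (Ne.symm hca)) ?_ (hm b hb c ⟨hc, hcv⟩ (Ne.symm hcb))
          · rw [Sym2.eq_swap]; simp [E]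
          · rw [Sym2.eq_swap]; simp [E]
        induction e with | _ c d =>
        obtain ⟨hcd, hc, hd⟩ := mk_mem_pairs.1 he
        by_cases hcv : c = v
        · subst hcv; exact key d hd hcd.symm
        by_cases hdv : d = v
        · subst hdv; rw [Sym2.eq_swap]; exact key c hc hcd
        exact row_mem_rowSpan p (Or.inl (mk_mem_pairs.2 ⟨hcd, ⟨hc, hcv⟩, ⟨hd, hdv⟩⟩))
      · refine rowSpan_mono p (Set.union_subset (pairs_mono Set.sdiff_subset) ?_)
        rintro _ (rfl | rfl)
        · exact mk_mem_pairs.2 ⟨hva, hv, ha.1⟩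
        · exact mk_mem_pairs.2 ⟨hvb, hv, hb.1⟩
    have hstress : stress p E = stress p (pairs (U \ {v})) := by
      refine le_antisymm (fun ω hω => ⟨hω.1, fun e he => ?_⟩) (stress_mono p Set.subset_union_left)
      have := hp.eq_zero_of_star_two hω.1 hva hvb hab fun w h1 h2 h3 => hω.2 _ (by
        simp [E, mk_mem_pairs, h2, h3, hva, hvb])
      by_cases h1 : e = s(v, a)
      · rw [h1, this.1]
      by_cases h2 : e = s(v, b)
      · rw [h2, this.2]
      exact hω.2 e (by simp [E, he, h1, h2])
    have hcard : E.ncard = (pairs (U \ {v})).ncard + 2 := by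
      rw [Set.ncard_union_eq, Set.ncard_pair (by simp [hab, hvb])]
      rw [Set.disjoint_right]
      rintro _ (rfl | rfl) <;> simp [mk_mem_pairs]
    have h1 := finrank_rowSpan_add p E
    have h2 := finrank_rowSpan_add p (pairs (U \ {v}))
    rw [ih _ hU'] at h2
    rw [hspan]
    rw [hstress] at h1
    omega

theorem Generic.finrank_rowSpan_add_three {p : V → Fin 2 → ℝ} (hp : Generic p) {U : Set V}
    (hU : 2 ≤ U.ncard) : Module.finrank ℝ (rowSpan p (pairs U)) + 3 = 2 * U.ncard := by
  have := hp.finrank_rowSpan_pairs (U.ncard - 2) U (by omega)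
  omega

theorem Generic.finrank_rowSpan_le {p : V → Fin 2 → ℝ} (hp : Generic p) {U : Set V}
    (hU : 2 ≤ U.ncard) {E : Set (Sym2 V)} (hE : E ⊆ pairs U) :
    Module.finrank ℝ (rowSpan p E) + 3 ≤ 2 * U.ncard := by
  rw [← hp.finrank_rowSpan_add_three hU]
  exact Nat.add_le_add_right (Submodule.finrank_mono (rowSpan_mono p hE)) 3

theorem two_mul_choose_two (n : ℕ) : 2 * (n.choose 2 : ℤ) = n * (n - 1) := by
  have h3 : 2 * n.choose 2 = n * (n - 1) := by
    rw [Nat.choose_two_right, Nat.mul_div_cancel' (Nat.even_mul_pred_self _).two_dvd]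
  cases n with
  | zero => simp
  | succ n =>
    zify at h3
    rw [h3]; simp

theorem Generic.two_mul_finrank_stress_pairs {p : V → Fin 2 → ℝ} (hp : Generic p) {U : Set V}
    (hU : 2 ≤ U.ncard) : 2 * (Module.finrank ℝ (stress p (pairs U)) : ℤ) =
      ((U.ncard : ℤ) - 2) * (U.ncard - 3) := by
  have h1 := finrank_rowSpan_add p (pairs U)
  have h2 := hp.finrank_rowSpan_add_three hU
  have h3 := two_mul_choose_two U.ncard
  rw [ncard_pairs] at h1
  zify at h1 h2
  linear_combination 2 * h1 - 2 * h2 + h3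

theorem Generic.stress_pairs_eq_bot {p : V → Fin 2 → ℝ} (hp : Generic p) {U : Set V}
    (hU : U.ncard ≤ 3) : stress p (pairs U) = ⊥ := by
  by_cases h : 2 ≤ U.ncard
  · have h1 := hp.two_mul_finrank_stress_pairs h
    rw [← Submodule.finrank_eq_zero]
    have : U.ncard = 2 ∨ U.ncard = 3 := by omega
    rcases this with h2 | h2 <;> rw [h2] at h1 <;> simpa using h1
  · have : pairs U = ∅ := by
      rw [← Set.ncard_eq_zero, ncard_pairs]
      exact Nat.choose_eq_zero_of_lt (by omega)
    refine (Submodule.eq_bot_iff _).2 fun ω hω => ?_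
    ext e
    exact hω.2 e (by simp [this])

theorem sum_ncard_neighborSet (H : SimpleGraph V) :
    ∑ v, (H.neighborSet v).ncard = 2 * H.edgeSet.ncard := by
  classical
  rw [← SimpleGraph.coe_edgeFinset, Set.ncard_coe_finset, ← H.sum_degrees_eq_twice_card_edges]
  refine Finset.sum_congr rfl fun v _ => ?_
  rw [← SimpleGraph.card_neighborSet_eq_degree, ← Nat.card_eq_fintype_card, Nat.card_coe_set_eq]

/-- Two neighbours of a vertex are adjacent as soon as the rest of the graph rigidly links them
to each other and to a third neighbour. -/
def Closed (p : V → Fin 2 → ℝ) (H : SimpleGraph V) : Prop :=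
  ∀ v x y z, H.Adj v x → H.Adj v y → H.Adj v z → x ≠ y → x ≠ z → y ≠ z →
    InCl p {e ∈ H.edgeSet | v ∉ e} s(x, y) → InCl p {e ∈ H.edgeSet | v ∉ e} s(y, z) →
    InCl p {e ∈ H.edgeSet | v ∉ e} s(x, z) → H.Adj x y

/-- The vertices touched by a function on pairs. -/
def touched (ω : Sym2 V → ℝ) : Set V := {v | ∃ w, ω s(v, w) ≠ 0}

theorem Closed.exists_smaller {p : V → Fin 2 → ℝ} (hp : Generic p) {H : SimpleGraph V}
    (hH : Closed p H) {ω : Sym2 V → ℝ} (hω : ω ∈ stress p H.edgeSet) (hω0 : ω ≠ 0)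
    (hmin : ∀ η ∈ stress p {e | ω e ≠ 0}, η ≠ 0 → ∀ e, ω e ≠ 0 → η e ≠ 0) :
    ∃ S : Set V, S.ncard = 4 ∧ H.IsClique S ∧ ∃ η ∈ stress p (pairs S),
      touched (ω - η) ⊂ touched ω := by
  set D : Set (Sym2 V) := {e | ω e ≠ 0} with hD
  have hDH : D ⊆ H.edgeSet := fun e he => by by_contra h; exact he (hω.2 e h)
  have hDnd : ∀ e ∈ D, ¬ e.IsDiag := fun e he => H.not_isDiag_of_mem_edgeSet (hDH he)
  have hωD : ω ∈ stress p D := ⟨hω.1, fun e he => by simpa [hD] using he⟩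
  obtain ⟨e₀, he₀⟩ := Function.ne_iff.1 hω0
  have hDpairs : D ⊆ pairs (touched ω) := by
    intro e he
    refine ⟨hDnd e he, fun w hw => ?_⟩
    obtain ⟨u, rfl⟩ := hw
    exact ⟨u, he⟩
  have hcard2 : 2 ≤ (touched ω).ncard := by
    have h1 : e₀ ∈ pairs (touched ω) := hDpairs he₀
    induction e₀ with | _ a b =>
    obtain ⟨h1, h2, h3⟩ := mk_mem_pairs.1 h1
    exact (Set.one_lt_ncard_iff (Set.toFinite _)).2 ⟨a, b, h2, h3, h1⟩
  have hDcard : D.ncard + 2 ≤ 2 * (touched ω).ncard := by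
    have h1 := hp.finrank_rowSpan_le hcard2 (E := D \ {e₀}) (Set.sdiff_subset.trans hDpairs)
    have h2 := finrank_rowSpan_add p (D \ {e₀})
    have h3 : stress p (D \ {e₀}) = ⊥ := by
      refine (Submodule.eq_bot_iff _).2 fun η hη => ?_
      by_contra h0
      exact hmin η (stress_mono p Set.sdiff_subset hη) h0 e₀ he₀ (hη.2 e₀ (by simp))
    rw [h3, finrank_bot, Set.ncard_sdiff_singleton_of_mem (show e₀ ∈ D from he₀)] at h2
    omega
  let K := SimpleGraph.fromEdgeSet D
  have hK : ∀ v w, K.Adj v w ↔ ω s(v, w) ≠ 0 := by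
    intro v w
    rw [SimpleGraph.fromEdgeSet_adj]
    exact ⟨fun h => h.1, fun h => ⟨h, fun hvw => hDnd _ h (by simp [hvw])⟩⟩
  have hKe : K.edgeSet = D := by
    ext e
    induction e with | _ a b =>
    rw [SimpleGraph.mem_edgeSet, hK]; rfl
  obtain ⟨v, hvt, hv3⟩ : ∃ v ∈ touched ω, (K.neighborSet v).ncard ≤ 3 := by
    by_contra! hcon
    have h1 := sum_ncard_neighborSet K
    have h2 : ∑ v ∈ (Set.toFinite (touched ω)).toFinset, 4 ≤ ∑ v, (K.neighborSet v).ncard :=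
      (Finset.sum_le_sum fun v hv => hcon v (by simpa using hv)).trans
        (Finset.sum_le_univ_sum_of_nonneg fun _ => Nat.zero_le _)
    rw [Finset.sum_const, smul_eq_mul, ← Set.ncard_eq_toFinset_card, h1, hKe] at h2
    omega
  have hnbr : ∀ w, w ∉ K.neighborSet v → ω s(v, w) = 0 := by
    intro w hw
    by_contra h
    exact hw ((hK v w).2 h)
  obtain ⟨w₀, hw₀⟩ := hvt
  have hpos : 0 < (K.neighborSet v).ncard :=
    (Set.ncard_pos (Set.toFinite _)).2 ⟨w₀, (hK v w₀).2 hw₀⟩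
  have h1 : (K.neighborSet v).ncard ≠ 1 := by
    intro h
    obtain ⟨a, ha⟩ := Set.ncard_eq_one.1 h
    have hva : K.Adj v a := by rw [← SimpleGraph.mem_neighborSet, ha]; rfl
    exact (hK v a).1 hva (hp.eq_zero_of_star_one hω.1 hva.ne fun w _ h2 => hnbr w (by simp [ha, h2]))
  have h2 : (K.neighborSet v).ncard ≠ 2 := by
    intro h
    obtain ⟨a, b, hab, ha⟩ := Set.ncard_eq_two.1 h
    have hva : K.Adj v a := by rw [← SimpleGraph.mem_neighborSet, ha]; simp
    have hvb : K.Adj v b := by rw [← SimpleGraph.mem_neighborSet, ha]; simp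
    exact (hK v a).1 hva (hp.eq_zero_of_star_two hω.1 hva.ne hvb.ne hab
      fun w _ h2 h3 => hnbr w (by simp [ha, h2, h3])).1
  obtain ⟨x, y, z, hxy, hxz, hyz, hxyz⟩ := Set.ncard_eq_three.1
    (show (K.neighborSet v).ncard = 3 by omega)
  have hvx : K.Adj v x := by rw [← SimpleGraph.mem_neighborSet, hxyz]; simp
  have hvy : K.Adj v y := by rw [← SimpleGraph.mem_neighborSet, hxyz]; simp
  have hvz : K.Adj v z := by rw [← SimpleGraph.mem_neighborSet, hxyz]; simp
  have hKH : ∀ w, K.Adj v w → H.Adj v w := fun w hw => hDH ((hK v w).1 hw)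
  let D' : Set (Sym2 V) := {e ∈ D | v ∉ e}
  have hD'H : D' ⊆ {e ∈ H.edgeSet | v ∉ e} := fun e he => ⟨hDH he.1, he.2⟩
  have hcl : ∀ x y z, x ≠ y → x ≠ z → y ≠ z → K.neighborSet v = {x, y, z} →
      InCl p {e ∈ H.edgeSet | v ∉ e} s(x, y) := by
    intro x y z hxy hxz hyz hxyz
    have hvx : K.Adj v x := by rw [← SimpleGraph.mem_neighborSet, hxyz]; simp
    have hvy : K.Adj v y := by rw [← SimpleGraph.mem_neighborSet, hxyz]; simp
    have hvz : K.Adj v z := by rw [← SimpleGraph.mem_neighborSet, hxyz]; simp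
    refine InCl.mono ?_ hD'H
    by_cases hxyD : s(x, y) ∈ D'
    · exact row_mem_rowSpan p hxyD
    have hne : stress p (insert s(x, y) D') ≠ ⊥ := by
      intro hbot
      have := hp.stress_eq_bot_of_star (fun e he => he.2) hvx.ne hvy.ne hvz.ne hxy hxz hyz hxyD hbot
      refine hω0 ((Submodule.eq_bot_iff _).1 this ω ⟨hω.1, fun e he => ?_⟩)
      by_contra hωe
      refine he ?_
      by_cases hve : v ∈ e
      · obtain ⟨w, rfl⟩ := hve
        have : w ∈ K.neighborSet v := (hK v w).2 hωe
        rw [hxyz] at this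
        simp only [Set.mem_insert_iff, Set.mem_singleton_iff] at this
        rcases this with rfl | rfl | rfl <;> simp
      · exact Or.inl ⟨hωe, hve⟩
    obtain ⟨η, hη, hη0⟩ := (Submodule.ne_bot_iff _).1 hne
    refine inCl_of_stress hη.1 (e := s(x, y)) (fun h0 => ?_) fun f hf hηf => ?_
    · have hηD' : ∀ e, e ∉ D' → η e = 0 := by
        intro e he
        by_cases h : e = s(x, y)
        · rw [h, h0]
        · exact hη.2 e (by simp [h, he])
      exact hmin η ⟨hη.1, fun e he => hηD' e fun h => he h.1⟩ hη0 s(v, x) ((hK v x).1 hvx)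
        (hηD' _ fun h => h.2 (by simp))
    · by_contra h
      exact hηf (hη.2 f (by simp [hf, h]))
  have e1 : ({x, y, z} : Set V) = {y, z, x} := by ext; simp; tauto
  have e2 : ({x, y, z} : Set V) = {x, z, y} := by ext; simp; tauto
  have c1 := hcl x y z hxy hxz hyz hxyz
  have c2 := hcl y z x hyz hxy.symm hxz.symm (hxyz.trans e1)
  have c3 := hcl x z y hxz hxy hyz.symm (hxyz.trans e2)
  have a1 : H.Adj x y := hH v x y z (hKH _ hvx) (hKH _ hvy) (hKH _ hvz) hxy hxz hyz c1 c2 c3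
  have a2 : H.Adj y z := hH v y z x (hKH _ hvy) (hKH _ hvz) (hKH _ hvx) hyz hxy.symm hxz.symm c2
    (by rwa [Sym2.eq_swap]) (by rwa [Sym2.eq_swap])
  have a3 : H.Adj x z := hH v x z y (hKH _ hvx) (hKH _ hvz) (hKH _ hvy) hxz hxy hyz.symm c3
    (by rwa [Sym2.eq_swap]) c1
  have hstar : ∀ w, w ≠ x → w ≠ y → w ≠ z → ω s(v, w) = 0 := fun w h1 h2 h3 =>
    hnbr w (by simp [hxyz, h1, h2, h3])
  have hforce : ∀ i, ω s(v, x) * (p v i - p x i) + ω s(v, y) * (p v i - p y i) +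
      ω s(v, z) * (p v i - p z i) = 0 := by
    intro i
    rw [← forceMap_star p hxy hxz hyz hstar, show forceMap p ω = 0 from hω.1]; rfl
  let τ := ω s(v, x) + ω s(v, y) + ω s(v, z)
  have hτ : τ ≠ 0 := by
    intro hτ
    have hdet := hp.det_ne_zero hxz.symm hyz.symm hxy
    refine (hK v x).1 hvx ((mul_eq_zero.1 (?_ : ω s(v, x) * _ = 0)).resolve_right hdet)
    have h0 := hforce 0
    have h1 := hforce 1
    simp only [τ] at hτ
    linear_combination -(p y 1 - p z 1) * h0 + (p y 0 - p z 0) * h1 +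
      ((p y 1 - p z 1) * (p v 0 - p z 0) - (p y 0 - p z 0) * (p v 1 - p z 1)) * hτ
  let μ : V → ℝ := fun w => if w = v then -τ else ω s(v, w)
  have hμv : μ v = -τ := by simp [μ]
  have hμ : ∀ w, w ≠ v → μ w = ω s(v, w) := fun w hw => by simp [μ, hw]
  have hsum : ∀ f : V → ℝ, ∑ w, μ w * f w = -τ * f v + ω s(v, x) * f x + ω s(v, y) * f y +
      ω s(v, z) * f z := by
    intro f
    rw [← Finset.sum_subset (Finset.subset_univ {v, x, y, z})]
    · rw [Finset.sum_insert (by simp [hvx.ne, hvy.ne, hvz.ne]), Finset.sum_insert (by simp [hxy, hxz]),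
        Finset.sum_pair hyz, hμv, hμ x hvx.ne.symm, hμ y hvy.ne.symm, hμ z hvz.ne.symm]
      ring
    · intro w _ hw
      simp only [Finset.mem_insert, Finset.mem_singleton, not_or] at hw
      rw [hμ w hw.1, hstar w hw.2.1 hw.2.2.1 hw.2.2.2, zero_mul]
  have hst : affineStress μ ∈ stress p (pairs {v, x, y, z}) := by
    refine affineStress_mem ?_ ?_ ?_
    · intro w hw
      simp only [Set.mem_insert_iff, Set.mem_singleton_iff, not_or] at hw
      rw [hμ w hw.1, hstar w hw.2.1 hw.2.2.1 hw.2.2.2]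
    · have := hsum fun _ => 1
      simp only [mul_one] at this
      rw [this]; simp only [τ]; ring
    · intro i
      rw [hsum fun w => p w i]
      simp only [τ]
      linear_combination - hforce i
  refine ⟨{v, x, y, z}, ?_, ?_, (-τ)⁻¹ • affineStress μ, Submodule.smul_mem _ _ hst, ?_⟩
  · rw [Set.ncard_insert_of_notMem (by simp [hvx.ne, hvy.ne, hvz.ne]),
      Set.ncard_eq_three.2 ⟨x, y, z, hxy, hxz, hyz, rfl⟩]
  · intro a ha b hb hab
    have b1 := hKH _ hvx
    have b2 := hKH _ hvy
    have b3 := hKH _ hvz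
    simp only [Set.mem_insert_iff, Set.mem_singleton_iff] at ha hb
    rcases ha with rfl | rfl | rfl | rfl <;> rcases hb with rfl | rfl | rfl | rfl <;>
    first
    | exact absurd rfl hab
    | assumption
    | (apply SimpleGraph.Adj.symm; assumption)
  · have hv0 : v ∉ touched (ω - (-τ)⁻¹ • affineStress μ) := by
      rintro ⟨w, hw⟩
      apply hw
      by_cases hvw : v = w
      · subst hvw
        have : ω s(v, v) = 0 := hω.2 _ (by simp)
        simp [this, affineStress]
      · have hτ' := neg_ne_zero.2 hτ
        rw [Pi.sub_apply, Pi.smul_apply, affineStress_mk μ hvw, hμv, hμ w (Ne.symm hvw), smul_eq_mul,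
          inv_mul_cancel_left₀ hτ', sub_self]
    have htv : v ∈ touched ω := ⟨w₀, hw₀⟩
    refine (Set.ssubset_iff_of_subset ?_).2 ⟨v, htv, hv0⟩
    rintro a ⟨w, hw⟩
    by_contra ha
    have h0 : ∀ w, ω s(a, w) = 0 := by simpa [touched] using ha
    have hav : ∀ u, K.Adj v u → a ≠ u := by
      rintro u hu rfl
      exact (hK v a).1 hu (by rw [Sym2.eq_swap]; exact h0 v)
    have hav' : a ≠ v := by rintro rfl; exact ha htv
    refine hw ?_
    rw [Pi.sub_apply, Pi.smul_apply, h0, hst.2 s(a, w) (by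
      rw [mk_mem_pairs]; simp [hav', hav x hvx, hav y hvy, hav z hvz])]
    simp

/-- The stress space of a closed graph is generated by the stresses of its complete subgraphs on
four vertices. -/
theorem Closed.stress_le {p : V → Fin 2 → ℝ} (hp : Generic p) {H : SimpleGraph V} (hH : Closed p H)
    (M : Submodule ℝ (Sym2 V → ℝ))
    (hM : ∀ S : Set V, S.ncard = 4 → H.IsClique S → stress p (pairs S) ≤ M) :
    stress p H.edgeSet ≤ M := by
  classical
  let m (ω : Sym2 V → ℝ) : ℕ := (touched ω).ncard * (Fintype.card (Sym2 V) + 1) + {e | ω e ≠ 0}.ncard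
  have hcard (ω : Sym2 V → ℝ) : {e | ω e ≠ 0}.ncard ≤ Fintype.card (Sym2 V) := by
    rw [← Nat.card_eq_fintype_card]; exact Set.ncard_le_card _
  have hsupp {ω η : Sym2 V → ℝ} (h : {e | η e ≠ 0} ⊂ {e | ω e ≠ 0}) : m η < m ω := by
    refine Nat.add_lt_add_of_le_of_lt (Nat.mul_le_mul_right _ (Set.ncard_le_ncard ?_ (Set.toFinite _)))
      (Set.ncard_lt_ncard h (Set.toFinite _))
    rintro v ⟨w, hw⟩
    exact ⟨w, h.1 hw⟩
  intro ω hω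
  induction hn : m ω using Nat.strong_induction_on generalizing ω with
  | _ n ih =>
  by_cases hω0 : ω = 0
  · rw [hω0]; exact M.zero_mem
  by_cases hmin : ∀ η ∈ stress p {e | ω e ≠ 0}, η ≠ 0 → ∀ e, ω e ≠ 0 → η e ≠ 0
  · obtain ⟨S, hS, hcl, η, hη, ht⟩ := hH.exists_smaller hp hω hω0 hmin
    have hSH : pairs S ⊆ H.edgeSet := by
      intro e he
      induction e with | _ a b =>
      obtain ⟨h1, h2, h3⟩ := mk_mem_pairs.1 he
      exact hcl h2 h3 h1
    have hηH := stress_mono p hSH hη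
    have := ih (m (ω - η)) ?_ (Submodule.sub_mem _ hω hηH) rfl
    · have h2 := M.add_mem this (hM S hS hcl hη)
      rwa [sub_add_cancel] at h2
    · rw [← hn]
      have h1 := Set.ncard_lt_ncard ht (Set.toFinite _)
      have h2 := hcard (ω - η)
      have h3 := Nat.mul_le_mul_right (Fintype.card (Sym2 V) + 1) (Nat.succ_le_of_lt h1)
      simp only [m]
      rw [Nat.succ_mul] at h3
      omega
  · push Not at hmin
    obtain ⟨η, hη, hη0, e, hωe, hηe⟩ := hmin
    have hsub : ∀ f, η f ≠ 0 → ω f ≠ 0 := fun f hf => by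
      by_contra h
      exact hf (hη.2 f (by simpa using h))
    have hηH : η ∈ stress p H.edgeSet := ⟨hη.1, fun f hf => by
      by_contra h
      exact hsub f h (hω.2 f hf)⟩
    obtain ⟨f, hf⟩ := Function.ne_iff.1 hη0
    have h1 : η ∈ M := by
      refine ih (m η) ?_ hηH rfl
      rw [← hn]
      exact hsupp ((Set.ssubset_iff_of_subset hsub).2 ⟨e, hωe, fun h => h hηe⟩)
    have h2 : ω - (ω f / η f) • η ∈ M := by
      refine ih (m (ω - (ω f / η f) • η)) ?_
        (Submodule.sub_mem _ hω (Submodule.smul_mem _ (ω f / η f) hηH)) rfl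
      rw [← hn]
      refine hsupp ((Set.ssubset_iff_of_subset ?_).2 ⟨f, hsub f hf, ?_⟩)
      · intro g hg hωg
        have : η g = 0 := by by_contra h; exact hsub g h hωg
        exact hg (by simp [this, hωg])
      · have : η f ≠ 0 := hf
        simp [this]
    have := M.add_mem h2 (M.smul_mem (ω f / η f) h1)
    rwa [sub_add_cancel] at this

theorem finrank_finsetSup_le {ι W : Type*} [AddCommGroup W] [Module ℝ W] [FiniteDimensional ℝ W]
    (K : Finset ι) (M : ι → Submodule ℝ W) :
    Module.finrank ℝ ↥(K.sup M) ≤ ∑ k ∈ K, Module.finrank ℝ (M k) := by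
  classical
  induction K using Finset.induction_on with
  | empty => simp
  | insert a s ha ih =>
    rw [Finset.sup_insert, Finset.sum_insert ha]
    exact (Submodule.finrank_add_le_finrank_add_finrank _ _).trans (Nat.add_le_add_left ih _)

/-- An upper bound on the number of edges of a closed graph whose complete subgraphs on four
vertices are covered by given sets. -/
theorem Closed.two_mul_ncard_edgeSet_le {p : V → Fin 2 → ℝ} (hp : Generic p) {H : SimpleGraph V}
    (hH : Closed p H) {U : Set V} (hU : 2 ≤ U.ncard) (hHU : H.edgeSet ⊆ pairs U) {ι : Type*}
    (K : Finset ι) (A : ι → Set V) (hA : ∀ k ∈ K, 2 ≤ (A k).ncard)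
    (hcov : ∀ S : Set V, S.ncard = 4 → H.IsClique S → ∃ k ∈ K, S ⊆ A k) :
    2 * (H.edgeSet.ncard : ℤ) ≤
      4 * U.ncard - 6 + ∑ k ∈ K, (((A k).ncard : ℤ) - 2) * ((A k).ncard - 3) := by
  have h1 := finrank_rowSpan_add p H.edgeSet
  have h2 := hp.finrank_rowSpan_le hU hHU
  have h3 : stress p H.edgeSet ≤ K.sup fun k => stress p (pairs (A k)) := by
    refine hH.stress_le hp _ fun S hS hcl => ?_
    obtain ⟨k, hk, hSk⟩ := hcov S hS hcl
    exact (stress_mono p (pairs_mono hSk)).trans (Finset.le_sup (f := fun k => stress p (pairs (A k))) hk)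
  have h4 := (Submodule.finrank_mono h3).trans (finrank_finsetSup_le K _)
  have h5 : ∑ k ∈ K, (((A k).ncard : ℤ) - 2) * ((A k).ncard - 3) =
      2 * ((∑ k ∈ K, Module.finrank ℝ (stress p (pairs (A k))) : ℕ) : ℤ) := by
    rw [Nat.cast_sum, Finset.mul_sum]
    exact Finset.sum_congr rfl fun k hk => (hp.two_mul_finrank_stress_pairs (hA k hk)).symm
  rw [h5]
  omega

end

section

variable [Fintype V] [DecidableEq V]

theorem glc_adj {d : ℕ} {G : SimpleGraph V} {u v : V} :
    (glc d G).Adj u v ↔ u ≠ v ∧ GloballyLinked d G u v := by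
  have hs : ∀ {a b}, GloballyLinked d G a b → GloballyLinked d G b a := by
    intro a b h p hp q hq
    have hd : ∀ x y : Fin d → ℝ, eDist x y = eDist y x := fun x y => by
      simp only [eDist]; congr 1
      exact Finset.sum_congr rfl fun i _ => by ring
    rw [hd, h p hp q hq, hd]
  simp only [glc, SimpleGraph.sup_adj, SimpleGraph.fromEdgeSet_adj, Set.mem_ofPred_eq]
  constructor
  · rintro (h | ⟨⟨a, b, hab, h⟩, hne⟩)
    · exact ⟨h.ne, fun p _ q hq => (hq u v h).symm⟩
    · rcases Sym2.eq_iff.1 hab with ⟨rfl, rfl⟩ | ⟨rfl, rfl⟩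
      · exact ⟨hne, h⟩
      · exact ⟨hne, hs h⟩
  · rintro ⟨hne, h⟩
    exact Or.inr ⟨⟨u, v, rfl, h⟩, hne⟩

theorem le_glc (d : ℕ) (G : SimpleGraph V) : G ≤ glc d G := le_sup_left

theorem Generic.inCl_of_mem_glc {p : V → Fin 2 → ℝ} (hp : Generic p) {G : SimpleGraph V} {e : Sym2 V}
    (he : e ∈ (glc 2 G).edgeSet) : InCl p G.edgeSet e := by
  induction e with | _ u v =>
  exact hp.inCl_of_globallyLinkedIn ((glc_adj.1 he).2 p hp)

theorem Generic.lenSq_eq_of_mem_glc {p : V → Fin 2 → ℝ} (hp : Generic p) {G : SimpleGraph V}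
    {q : V → Fin 2 → ℝ} (hq : Equivalent G p q) {e : Sym2 V} (he : e ∈ (glc 2 G).edgeSet) :
    lenSq q e = lenSq p e := by
  induction e with | _ u v =>
  exact (eDist_eq_iff q p u v).1 ((glc_adj.1 he).2 p hp q hq)

/-- The globally linked closure is closed. -/
theorem Generic.closed_glc {p : V → Fin 2 → ℝ} (hp : Generic p) (G : SimpleGraph V) :
    Closed p (glc 2 G) := by
  intro v x y z hvx hvy hvz hxy hxz hyz h₁ h₂ h₃
  refine glc_adj.2 ⟨hxy, fun p' hp' q hq => (eDist_eq_iff q p' x y).2 ?_⟩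
  exact hp'.lenSq_eq_of_star (fun e he => he.2) hvx.ne hvy.ne hvz.ne hxy hxz hyz (hp.inCl hp' h₁)
    (hp.inCl hp' h₂) (hp.inCl hp' h₃) (fun e he => hp'.lenSq_eq_of_mem_glc hq he.1)
    (hp'.lenSq_eq_of_mem_glc hq hvx) (hp'.lenSq_eq_of_mem_glc hq hvy) (hp'.lenSq_eq_of_mem_glc hq hvz)

/-- The graph of the edges of `H` within `U`, on the same vertex type. -/
def within (H : SimpleGraph V) (U : Set V) : SimpleGraph V where
  Adj a b := H.Adj a b ∧ a ∈ U ∧ b ∈ U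
  symm := ⟨fun _ _ h => ⟨h.1.symm, h.2.2, h.2.1⟩⟩
  loopless := ⟨fun _ h => h.1.ne rfl⟩

theorem within_le (H : SimpleGraph V) (U : Set V) : within H U ≤ H := fun _ _ h => h.1

theorem edgeSet_within_subset (H : SimpleGraph V) (U : Set V) : (within H U).edgeSet ⊆ pairs U := by
  intro e he
  induction e with | _ a b =>
  exact mk_mem_pairs.2 ⟨SimpleGraph.Adj.ne (G := within H U) he, he.2⟩

theorem Closed.within_set {p : V → Fin 2 → ℝ} {H : SimpleGraph V} (hH : Closed p H) (U : Set V) :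
    Closed p (within H U) := by
  intro v x y z hvx hvy hvz hxy hxz hyz h₁ h₂ h₃
  have hsub : {e ∈ (within H U).edgeSet | v ∉ e} ⊆ {e ∈ H.edgeSet | v ∉ e} := fun e he =>
    ⟨SimpleGraph.edgeSet_mono (within_le H U) he.1, he.2⟩
  exact ⟨hH v x y z hvx.1 hvy.1 hvz.1 hxy hxz hyz (h₁.mono hsub) (h₂.mono hsub) (h₃.mono hsub),
    hvx.2.2, hvy.2.2⟩

theorem IsClique.subset_of_within {H : SimpleGraph V} {U S : Set V} (hS : (within H U).IsClique S)
    (h2 : 2 ≤ S.ncard) : S ⊆ U := by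
  intro a ha
  obtain ⟨b, hb, hba⟩ := Set.exists_ne_of_one_lt_ncard h2 a
  exact (hS ha hb hba.symm).2.1

/-- Vertices with three common, mutually adjacent neighbours are adjacent in a closed graph. -/
theorem Closed.adj_of_triangle {p : V → Fin 2 → ℝ} (hp : Generic p) {H : SimpleGraph V}
    (hH : Closed p H) {a b c x y : V} (hab : H.Adj a b) (hac : H.Adj a c) (hbc : H.Adj b c)
    (hxa : H.Adj x a) (hxb : H.Adj x b) (hxc : H.Adj x c) (hya : H.Adj y a) (hyb : H.Adj y b)
    (hyc : H.Adj y c) (hxy : x ≠ y) : H.Adj x y := by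
  have hmem : ∀ u w, H.Adj u w → u ≠ a → w ≠ a → s(u, w) ∈ {e ∈ H.edgeSet | a ∉ e} :=
    fun u w h h1 h2 => ⟨h, by simp [h1.symm, h2.symm]⟩
  refine hH a x y b hxa.symm hya.symm hab hxy hxb.ne hyb.ne ?_ ?_ ?_
  · exact hp.inCl_four hbc.ne hxb.ne.symm hyb.ne.symm hxc.ne.symm hyc.ne.symm hxy
      (hmem _ _ hbc hab.ne.symm hac.ne.symm) (hmem _ _ hxb.symm hab.ne.symm hxa.ne)
      (hmem _ _ hyb.symm hab.ne.symm hya.ne) (hmem _ _ hxc.symm hac.ne.symm hxa.ne)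
      (hmem _ _ hyc.symm hac.ne.symm hya.ne)
  · exact row_mem_rowSpan p (hmem _ _ hyb hya.ne hab.ne.symm)
  · exact row_mem_rowSpan p (hmem _ _ hxb hxa.ne hab.ne.symm)

/-- Distinct maximal cliques of a closed graph share at most two vertices. -/
theorem Closed.ncard_inter_le {p : V → Fin 2 → ℝ} (hp : Generic p) {H : SimpleGraph V}
    (hH : Closed p H) {X Y : Set V} (hX : Maximal H.IsClique X) (hY : Maximal H.IsClique Y)
    (hXY : X ≠ Y) : (X ∩ Y).ncard ≤ 2 := by
  by_contra! h
  obtain ⟨a, b, c, ha, hb, hc, hab, hac, hbc⟩ := (Set.two_lt_ncard_iff (Set.toFinite _)).1 h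
  have key : ∀ x ∈ X, ∀ y ∈ Y, x ≠ y → H.Adj x y := by
    intro x hx y hy hxy
    by_cases hxY : x ∈ Y
    · exact hY.1 hxY hy hxy
    by_cases hyX : y ∈ X
    · exact hX.1 hx hyX hxy
    have h1 : ∀ w ∈ X ∩ Y, H.Adj x w := fun w hw => hX.1 hx hw.1 fun h => hxY (h ▸ hw.2)
    have h2 : ∀ w ∈ X ∩ Y, H.Adj y w := fun w hw => hY.1 hy hw.2 fun h => hyX (h ▸ hw.1)
    exact hH.adj_of_triangle hp (hX.1 ha.1 hb.1 hab) (hX.1 ha.1 hc.1 hac) (hX.1 hb.1 hc.1 hbc)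
      (h1 a ha) (h1 b hb) (h1 c hc) (h2 a ha) (h2 b hb) (h2 c hc) hxy
  have hU : H.IsClique (X ∪ Y) := by
    rintro x (hx | hx) y (hy | hy) hxy
    · exact hX.1 hx hy hxy
    · exact key x hx y hy hxy
    · exact (key y hy x hx hxy.symm).symm
    · exact hY.1 hx hy hxy
  have h1 : X ∪ Y ⊆ X := hX.2 hU Set.subset_union_left
  have h2 : X ∪ Y ⊆ Y := hY.2 hU Set.subset_union_right
  exact hXY ((Set.subset_union_left.trans h2).antisymm (Set.subset_union_right.trans h1))

/-- A lower bound for degrees in terms of the cliques at a vertex. -/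
theorem Closed.le_two_mul_ncard_neighborSet {p : V → Fin 2 → ℝ} (hp : Generic p)
    {H : SimpleGraph V} (hH : Closed p H) {ι : Type*} [DecidableEq ι] (J : Finset ι) (D : ι → Set V)
    (hclique : ∀ k ∈ J, H.IsClique (D k)) (hcard : ∀ k ∈ J, 4 ≤ (D k).ncard)
    (hinter : ∀ k ∈ J, ∀ l ∈ J, k ≠ l → (D k ∩ D l).ncard ≤ 2) {v : V} (hv : ∀ k ∈ J, v ∈ D k)
    (hcov : ∀ S, H.IsClique S → 4 ≤ S.ncard → v ∈ S → ∃ k ∈ J, S ⊆ D k) (hJ : 2 ≤ J.card) :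
    8 + ∑ k ∈ J, (2 * ((D k).ncard : ℤ) - 7) ≤ 2 * (H.neighborSet v).ncard := by
  let A (k : ι) : Set V := D k \ {v}
  have hA : ∀ k ∈ J, (A k).ncard + 1 = (D k).ncard := fun k hk =>
    Set.ncard_sdiff_singleton_add_one (hv k hk)
  have hAN : ∀ k ∈ J, A k ⊆ H.neighborSet v := fun k hk w hw => hclique k hk (hv k hk) hw.1 (Ne.symm hw.2)
  have hAA : ∀ k ∈ J, ∀ l ∈ J, k ≠ l → (A k ∩ A l).ncard ≤ 1 := by
    intro k hk l hl hkl
    have h1 : A k ∩ A l = (D k ∩ D l) \ {v} := by ext; simp [A]; tauto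
    have h2 := Set.ncard_sdiff_singleton_add_one (s := D k ∩ D l) ⟨hv k hk, hv l hl⟩
    have h3 := hinter k hk l hl hkl
    rw [h1]; omega
  rcases hJ.eq_or_lt with h2 | h3
  · obtain ⟨k, l, hkl, rfl⟩ := Finset.card_eq_two.1 h2.symm
    have hk : k ∈ ({k, l} : Finset ι) := by simp
    have hl : l ∈ ({k, l} : Finset ι) := by simp
    have h1 := Set.ncard_union_add_ncard_inter (A k) (A l)
    have h2 := Set.ncard_le_ncard (Set.union_subset (hAN k hk) (hAN l hl)) (Set.toFinite _)
    have h3 := hAA k hk l hl hkl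
    have h4 := hA k hk
    have h5 := hA l hl
    rw [Finset.sum_pair hkl]
    omega
  · obtain ⟨k₀, hk₀⟩ : J.Nonempty := Finset.card_pos.1 (by omega)
    let L := within H (H.neighborSet v)
    have hN2 : 2 ≤ (H.neighborSet v).ncard := by
      have h1 := Set.ncard_le_ncard (hAN k₀ hk₀) (Set.toFinite _)
      have h2 := hA k₀ hk₀
      have h3 := hcard k₀ hk₀
      omega
    have hup := (hH.within_set (H.neighborSet v)).two_mul_ncard_edgeSet_le hp hN2 (edgeSet_within_subset _ _) J A
      (fun k hk => by have h2 := hA k hk; have h3 := hcard k hk; omega) (by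
        intro S hS hcl
        have hSN := IsClique.subset_of_within hcl (by omega)
        have hvS : v ∉ S := fun h => H.loopless.irrefl v (hSN h)
        obtain ⟨k, hk, hSk⟩ := hcov (insert v S) (by
          rintro a (rfl | ha) b (rfl | hb) hab
          · exact absurd rfl hab
          · exact hSN hb
          · exact (hSN ha : H.Adj b a).symm
          · exact (hcl ha hb hab).1) (by rw [Set.ncard_insert_of_notMem hvS]; omega) (Set.mem_insert _ _)
        exact ⟨k, hk, fun w hw => ⟨hSk (Set.mem_insert_of_mem _ hw), fun h => hvS (h ▸ hw)⟩⟩)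
    have hlow : ∑ k ∈ J, (A k).ncard.choose 2 ≤ L.edgeSet.ncard := by
      have hdisj : (↑J : Set ι).PairwiseDisjoint fun k => (Set.toFinite (pairs (A k))).toFinset := by
        intro k hk l hl hkl
        rw [Function.onFun, Set.Finite.disjoint_toFinset, Set.disjoint_iff_inter_eq_empty, ← pairs_inter,
          ← Set.ncard_eq_zero, ncard_pairs]
        exact Nat.choose_eq_zero_of_lt (Nat.lt_succ_of_le (hAA k hk l hl hkl))
      rw [Finset.sum_congr rfl fun k _ => (ncard_pairs (A k)).symm,
        Finset.sum_congr rfl fun k _ => Set.ncard_eq_toFinset_card (pairs (A k)),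
        ← Finset.card_biUnion hdisj, ← Set.ncard_coe_finset]
      refine Set.ncard_le_ncard ?_ (Set.toFinite _)
      intro e he
      simp only [Finset.coe_biUnion, Set.mem_iUnion, Set.Finite.coe_toFinset] at he
      obtain ⟨k, hk, he⟩ := he
      induction e with | _ a b =>
      obtain ⟨hab, ha, hb⟩ := mk_mem_pairs.1 he
      exact ⟨hclique k hk ha.1 hb.1 hab, hAN k hk ha, hAN k hk hb⟩
    have hlow' : ∑ k ∈ J, (((D k).ncard : ℤ) - 1) * ((D k).ncard - 2) ≤ 2 * L.edgeSet.ncard := by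
      have : ∑ k ∈ J, (((D k).ncard : ℤ) - 1) * ((D k).ncard - 2) =
          2 * ((∑ k ∈ J, (A k).ncard.choose 2 : ℕ) : ℤ) := by
        rw [Nat.cast_sum, Finset.mul_sum]
        refine Finset.sum_congr rfl fun k hk => ?_
        rw [two_mul_choose_two, ← hA k hk]
        push_cast; ring
      rw [this]; exact_mod_cast Nat.mul_le_mul_left 2 hlow
    have hup' : ∑ k ∈ J, (((A k).ncard : ℤ) - 2) * ((A k).ncard - 3) =
        ∑ k ∈ J, (((D k).ncard : ℤ) - 1) * ((D k).ncard - 2) - 2 * ∑ k ∈ J, (2 * ((D k).ncard : ℤ) - 7)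
          - 4 * J.card := by
      rw [Finset.mul_sum, ← Finset.sum_sub_distrib, mul_comm, ← nsmul_eq_mul, ← Finset.sum_const,
        ← Finset.sum_sub_distrib]
      refine Finset.sum_congr rfl fun k hk => ?_
      rw [← hA k hk]
      push_cast; ring
    rw [hup'] at hup
    change 2 * (L.edgeSet.ncard : ℤ) ≤ _ at hup
    have : (3 : ℤ) ≤ J.card := by exact_mod_cast h3
    linarith

/-- The vertices of a closed graph cannot be covered twice by its large maximal cliques. -/
theorem Closed.not_double_cover {p : V → Fin 2 → ℝ} (hp : Generic p) {H : SimpleGraph V}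
    (hH : Closed p H) {U : Set V} (hU : U.Nonempty) (hHU : H.edgeSet ⊆ pairs U) {ι : Type*}
    [DecidableEq ι] (J : Finset ι) (D : ι → Set V) (hDU : ∀ k ∈ J, D k ⊆ U)
    (hclique : ∀ k ∈ J, H.IsClique (D k)) (hcard : ∀ k ∈ J, 4 ≤ (D k).ncard)
    (hinter : ∀ k ∈ J, ∀ l ∈ J, k ≠ l → (D k ∩ D l).ncard ≤ 2)
    (hcov : ∀ S, H.IsClique S → 4 ≤ S.ncard → ∃ k ∈ J, S ⊆ D k)
    (htwo : ∀ v ∈ U, ∃ k ∈ J, ∃ l ∈ J, k ≠ l ∧ v ∈ D k ∧ v ∈ D l) : False := by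
  classical
  obtain ⟨u, hu⟩ := hU
  have hU2 : 2 ≤ U.ncard := by
    obtain ⟨k, hk, -⟩ := htwo u hu
    have h1 := Set.ncard_le_ncard (hDU k hk) (Set.toFinite _)
    have h2 := hcard k hk
    omega
  have hup := hH.two_mul_ncard_edgeSet_le hp hU2 hHU J D (fun k hk => by have := hcard k hk; omega)
    fun S hS hcl => hcov S hcl hS.ge
  have hdeg : ∀ v ∈ U.toFinset, 8 + ∑ k ∈ J, (if v ∈ D k then 2 * ((D k).ncard : ℤ) - 7 else 0) ≤
      2 * ((H.neighborSet v).ncard : ℤ) := by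
    intro v hv
    rw [← Finset.sum_filter]
    refine hH.le_two_mul_ncard_neighborSet hp (J.filter fun k => v ∈ D k) D
      (fun k hk => hclique k (Finset.mem_filter.1 hk).1) (fun k hk => hcard k (Finset.mem_filter.1 hk).1)
      (fun k hk l hl => hinter k (Finset.mem_filter.1 hk).1 l (Finset.mem_filter.1 hl).1)
      (fun k hk => (Finset.mem_filter.1 hk).2) ?_ ?_
    · intro S hS h4 hvS
      obtain ⟨k, hk, hSk⟩ := hcov S hS h4
      exact ⟨k, Finset.mem_filter.2 ⟨hk, hSk hvS⟩, hSk⟩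
    · obtain ⟨k, hk, l, hl, hkl, hvk, hvl⟩ := htwo v (by simpa using hv)
      exact Finset.one_lt_card.2
        ⟨k, Finset.mem_filter.2 ⟨hk, hvk⟩, l, Finset.mem_filter.2 ⟨hl, hvl⟩, hkl⟩
  have hsum := Finset.sum_le_sum hdeg
  have hle : ∑ v ∈ U.toFinset, 2 * ((H.neighborSet v).ncard : ℤ) ≤ 4 * H.edgeSet.ncard := by
    refine (Finset.sum_le_univ_sum_of_nonneg fun _ => by positivity).trans ?_
    rw [← Finset.mul_sum, ← Nat.cast_sum, sum_ncard_neighborSet]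
    push_cast; linarith
  have hswap : ∑ v ∈ U.toFinset, ∑ k ∈ J, (if v ∈ D k then 2 * ((D k).ncard : ℤ) - 7 else 0) =
      ∑ k ∈ J, ((D k).ncard : ℤ) * (2 * (D k).ncard - 7) := by
    rw [Finset.sum_comm]
    refine Finset.sum_congr rfl fun k hk => ?_
    rw [← Finset.sum_filter, Finset.sum_const, nsmul_eq_mul, Set.ncard_eq_toFinset_card' (D k)]
    congr 3
    ext w
    simpa using fun h => hDU k hk h
  rw [Finset.sum_add_distrib, hswap, Finset.sum_const, nsmul_eq_mul, ← Set.ncard_eq_toFinset_card'] at hsum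
  have hfin : 2 * ∑ k ∈ J, (((D k).ncard : ℤ) - 2) * ((D k).ncard - 3) ≤
      ∑ k ∈ J, ((D k).ncard : ℤ) * (2 * (D k).ncard - 7) := by
    rw [Finset.mul_sum]
    refine Finset.sum_le_sum fun k hk => ?_
    have : (4 : ℤ) ≤ (D k).ncard := by exact_mod_cast hcard k hk
    nlinarith
  linarith

/-- Every nonempty family of large maximal cliques of a closed graph has a member meeting the
union of the others in at most three vertices. -/
theorem Closed.exists_ncard_inter_le {p : V → Fin 2 → ℝ} (hp : Generic p) {H : SimpleGraph V}
    (hH : Closed p H) {ι : Type*} [Fintype ι] [DecidableEq ι] (C : ι → Set V)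
    (hclique : ∀ i, H.IsClique (C i)) (hinter : ∀ i j, i ≠ j → (C i ∩ C j).ncard ≤ 2)
    (hcov : ∀ S, H.IsClique S → 4 ≤ S.ncard → ∃ i, S ⊆ C i) (I : Finset ι) (hI : I.Nonempty) :
    ∃ j ∈ I, ((⋃ i ∈ I.erase j, C i) ∩ C j).ncard ≤ 3 := by
  classical
  by_contra! hcon
  let U : Set V := {v | ∃ i ∈ I, ∃ j ∈ I, i ≠ j ∧ v ∈ C i ∧ v ∈ C j}
  have hsub : ∀ j ∈ I, (⋃ i ∈ I.erase j, C i) ∩ C j ⊆ C j ∩ U := by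
    rintro j hj v ⟨hv, hvj⟩
    simp only [Set.mem_iUnion, Finset.mem_erase] at hv
    obtain ⟨i, ⟨hij, hi⟩, hvi⟩ := hv
    exact ⟨hvj, i, hi, j, hj, hij, hvi, hvj⟩
  have hIcard : ∀ j ∈ I, 4 ≤ (C j ∩ U).ncard := fun j hj =>
    (hcon j hj).trans_le (Set.ncard_le_ncard (hsub j hj) (Set.toFinite _))
  let J : Finset ι := Finset.univ.filter fun k => 4 ≤ (C k ∩ U).ncard
  have hJ : ∀ k, k ∈ J ↔ 4 ≤ (C k ∩ U).ncard := by simp [J]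
  refine (hH.within_set U).not_double_cover hp (U := U) ?_ (edgeSet_within_subset _ _) J (fun k => C k ∩ U)
    (fun k _ => Set.inter_subset_right) ?_ (fun k hk => (hJ k).1 hk) ?_ ?_ ?_
  · obtain ⟨j, hj⟩ := hI
    have : (C j ∩ U).Nonempty := Set.nonempty_of_ncard_ne_zero (by have := hIcard j hj; omega)
    exact this.mono Set.inter_subset_right
  · intro k _ a ha b hb hab
    exact ⟨hclique k ha.1 hb.1 hab, ha.2, hb.2⟩
  · intro k _ l _ hkl
    exact (Set.ncard_le_ncard (Set.inter_subset_inter Set.inter_subset_left Set.inter_subset_left)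
      (Set.toFinite _)).trans (hinter k l hkl)
  · intro S hS h4
    obtain ⟨k, hk⟩ := hcov S (fun a ha b hb hab => (hS ha hb hab).1) h4
    have hSU : S ⊆ C k ∩ U := Set.subset_inter hk (IsClique.subset_of_within hS (by omega))
    exact ⟨k, (hJ k).2 (h4.trans (Set.ncard_le_ncard hSU (Set.toFinite _))), hSU⟩
  · rintro v ⟨i, hi, j, hj, hij, hvi, hvj⟩
    have hvU : v ∈ U := ⟨i, hi, j, hj, hij, hvi, hvj⟩
    exact ⟨i, (hJ i).2 (hIcard i hi), j, (hJ j).2 (hIcard j hj), hij, ⟨hvi, hvU⟩, hvj, hvU⟩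

end

section

variable [Fintype V] [DecidableEq V]

/-- Repeatedly removing a member produces an ordering of a finite family. -/
theorem exists_shelling {ι : Type*} [DecidableEq ι] (C : ι → Set V)
    (h : ∀ I : Finset ι, I.Nonempty → ∃ j ∈ I, ((⋃ i ∈ I.erase j, C i) ∩ C j).ncard ≤ 3)
    (n : ℕ) (I : Finset ι) (hn : I.card = n) : ∃ f : Fin n → ι, Function.Injective f ∧
      (∀ i, i ∈ I ↔ ∃ k, f k = i) ∧ ∀ j, ((⋃ (i : Fin n) (_ : i < j), C (f i)) ∩ C (f j)).ncard ≤ 3 := by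
  induction n generalizing I with
  | zero =>
    obtain rfl := Finset.card_eq_zero.1 hn
    exact ⟨Fin.elim0, fun i => i.elim0, by simp, fun i => i.elim0⟩
  | succ n ih =>
    obtain ⟨j, hj, hjI⟩ := h I (Finset.card_pos.1 (by omega))
    obtain ⟨f, hf, hfI, hsh⟩ := ih (I.erase j) (by rw [Finset.card_erase_of_mem hj, hn]; rfl)
    have hfj : ∀ k, f k ∈ I.erase j := fun k => (hfI _).2 ⟨k, rfl⟩
    refine ⟨Fin.snoc (α := fun _ => ι) f j, ?_, ?_, ?_⟩
    · rw [Fin.snoc_injective_iff]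
      exact ⟨hf, fun ⟨k, hk⟩ => by simpa [hk] using hfj k⟩
    · intro i
      constructor
      · intro hi
        by_cases hij : i = j
        · exact ⟨Fin.last n, by simp [hij]⟩
        · obtain ⟨k, hk⟩ := (hfI i).1 (Finset.mem_erase.2 ⟨hij, hi⟩)
          exact ⟨k.castSucc, by simp [hk]⟩
      · rintro ⟨k, rfl⟩
        induction k using Fin.lastCases with
        | last => simpa using hj
        | cast k => simpa using Finset.mem_of_mem_erase (hfj k)
    · intro k
      induction k using Fin.lastCases with
      | last =>
        refine (Set.ncard_le_ncard ?_ (Set.toFinite _)).trans hjI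
        rintro v ⟨hv, hvj⟩
        simp only [Set.mem_iUnion] at hv
        obtain ⟨i, hi, hv⟩ := hv
        induction i using Fin.lastCases with
        | last => exact absurd hi (lt_irrefl _)
        | cast i =>
          rw [Fin.snoc_castSucc] at hv
          rw [Fin.snoc_last] at hvj
          exact ⟨Set.mem_biUnion (hfj i) hv, hvj⟩
      | cast k =>
        refine (Set.ncard_le_ncard ?_ (Set.toFinite _)).trans (hsh k)
        rintro v ⟨hv, hvk⟩
        simp only [Set.mem_iUnion] at hv
        obtain ⟨i, hi, hv⟩ := hv
        induction i using Fin.lastCases with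
        | last => exact absurd hi (not_lt_of_ge (Fin.le_last _))
        | cast i =>
          rw [Fin.snoc_castSucc] at hv hvk
          refine ⟨?_, hvk⟩
          simp only [Set.mem_iUnion]
          exact ⟨i, by simpa using hi, hv⟩

theorem sup_stress_le_suppOn {p : V → Fin 2 → ℝ} {ι : Type*} (C : ι → Set V) (I : Finset ι) :
    I.sup (fun i => stress p (pairs (C i))) ≤ suppOn (⋃ i ∈ I, pairs (C i)) :=
  Finset.sup_le fun _ hi _ hω e he => hω.2 e fun h => he (Set.mem_biUnion hi h)

/-- Stress spaces of complete graphs in a 3-shellable family are independent. -/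
theorem Generic.finrank_sup_stress {p : V → Fin 2 → ℝ} (hp : Generic p) {ι : Type*} [DecidableEq ι]
    (C : ι → Set V)
    (h : ∀ I : Finset ι, I.Nonempty → ∃ j ∈ I, ((⋃ i ∈ I.erase j, C i) ∩ C j).ncard ≤ 3)
    (I : Finset ι) : Module.finrank ℝ ↥(I.sup fun i => stress p (pairs (C i))) =
      ∑ i ∈ I, Module.finrank ℝ (stress p (pairs (C i))) := by
  induction hn : I.card generalizing I with
  | zero =>
    obtain rfl := Finset.card_eq_zero.1 hn
    simp
  | succ n ih =>
    obtain ⟨j, hj, hjI⟩ := h I (Finset.card_pos.1 (by omega))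
    have hinf : stress p (pairs (C j)) ⊓ (I.erase j).sup (fun i => stress p (pairs (C i))) = ⊥ := by
      rw [eq_bot_iff, ← hp.stress_pairs_eq_bot hjI]
      rintro ω ⟨hω, hω'⟩
      refine ⟨hω.1, fun e he => ?_⟩
      by_cases hej : e ∈ pairs (C j)
      · refine sup_stress_le_suppOn C _ hω' e fun hmem => he ?_
        simp only [Set.mem_iUnion] at hmem
        obtain ⟨i, hi, hei⟩ := hmem
        exact ⟨hej.1, fun w hw => ⟨Set.mem_biUnion hi (hei.2 w hw), hej.2 w hw⟩⟩
      · exact hω.2 e hej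
    have hsup := Submodule.finrank_sup_add_finrank_inf_eq (stress p (pairs (C j)))
      ((I.erase j).sup fun i => stress p (pairs (C i)))
    rw [hinf, finrank_bot, add_zero, ih (I.erase j) (by rw [Finset.card_erase_of_mem hj, hn]; rfl),
      Finset.add_sum_erase I (fun i => Module.finrank ℝ (stress p (pairs (C i)))) hj] at hsup
    have hins : (I.sup fun i => stress p (pairs (C i))) =
        stress p (pairs (C j)) ⊔ (I.erase j).sup fun i => stress p (pairs (C i)) := by
      conv_lhs => rw [← Finset.insert_erase hj]
      rw [Finset.sup_insert]
    rw [hins, hsup]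

theorem IsCluster.maximal {G : SimpleGraph V} {X : Set V} (h : IsCluster 2 G X) :
    Maximal (glc 2 G).IsClique X :=
  ⟨fun _ ha _ hb hab => h.1 _ ha _ hb hab,
    fun Y hY hXY => (h.2 Y hXY fun _ ha _ hb hab => hY ha hb hab).le⟩

theorem exists_isCluster_superset {G : SimpleGraph V} {S : Set V} (hS : (glc 2 G).IsClique S) :
    ∃ X, IsCluster 2 G X ∧ S ⊆ X := by
  obtain ⟨X, hSX, hX⟩ := (Set.toFinite {Y | (glc 2 G).IsClique Y}).exists_le_maximal hS
  refine ⟨X, ⟨fun a ha b hb hab => hX.1 ha hb hab, fun Y hXY hY => ?_⟩, hSX⟩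
  exact (hX.2 (fun _ ha _ hb hab => hY _ ha _ hb hab) hXY).antisymm hXY

theorem sum_multiplicity {ι : Type*} [Fintype ι] (P : ι → Set (Sym2 V)) :
    ∑ e, ({i | e ∈ P i}.ncard - 1) + (⋃ i, P i).ncard = ∑ i, (P i).ncard := by
  classical
  have h1 : ∀ i, (P i).ncard = ∑ e, if e ∈ P i then 1 else 0 := fun i => by
    rw [Set.ncard_eq_toFinset_card', Finset.card_eq_sum_ones, ← Finset.sum_filter]
    congr 1; ext; simp
  have h2 : (⋃ i, P i).ncard = ∑ e, if e ∈ ⋃ i, P i then 1 else 0 := by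
    rw [Set.ncard_eq_toFinset_card', Finset.card_eq_sum_ones, ← Finset.sum_filter]
    congr 1; ext; simp
  rw [Finset.sum_congr rfl fun i _ => h1 i, Finset.sum_comm, h2, ← Finset.sum_add_distrib]
  refine Finset.sum_congr rfl fun e _ => ?_
  have h3 : {i | e ∈ P i}.ncard = ∑ i, if e ∈ P i then 1 else 0 := by
    rw [Set.ncard_eq_toFinset_card', Finset.card_eq_sum_ones, ← Finset.sum_filter]
    congr 1; ext; simp
  rw [← h3]
  by_cases h : e ∈ ⋃ i, P i
  · have : 0 < {i | e ∈ P i}.ncard := by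
      obtain ⟨i, hi⟩ := Set.mem_iUnion.1 h
      exact (Set.ncard_pos (Set.toFinite _)).2 ⟨i, hi⟩
    rw [if_pos h]; omega
  · have : {i | e ∈ P i} = ∅ := by
      ext i
      simpa using fun hi => h (Set.mem_iUnion.2 ⟨i, hi⟩)
    simp [h, this]

end

open Classical in
/-- With `𝒞 = {C₁,…,C_s}` the globally 2-linked clusters of `G` of size at least
four and `F` the set of edges of `G` induced by no member of `𝒞`:
`r₂(G) = |F| + Σᵢ (2|Cᵢ| − 3) − Σ_{{u,v} ∈ H(𝒞)} (h_𝒞(uv) − 1)`, and `𝒞` has a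
3-shellable ordering. -/
theorem cluster_cover {V : Type*} [Fintype V] [DecidableEq V]
    (G : SimpleGraph V) (s : ℕ) (C : Fin s → Set V) (hinj : Function.Injective C)
    (hC : ∀ i, IsCluster 2 G (C i) ∧ 4 ≤ (C i).ncard)
    (hall : ∀ X : Set V, IsCluster 2 G X → 4 ≤ X.ncard → ∃ i, X = C i)
    (F : Set (Sym2 V)) (hF : F = {e ∈ G.edgeSet | ¬ ∃ i, ∀ w ∈ e, w ∈ C i}) :
    (rd 2 G.edgeSet +
        ∑ e : Sym2 V,
          (if ¬ e.IsDiag ∧ 2 ≤ {i : Fin s | ∀ w ∈ e, w ∈ C i}.ncard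
            then {i : Fin s | ∀ w ∈ e, w ∈ C i}.ncard - 1 else 0) =
      F.ncard + ∑ i, (2 * (C i).ncard - 3)) ∧
    ∃ σ : Equiv.Perm (Fin s), ∀ j : Fin s,
      ((⋃ (i : Fin s) (_ : i < j), C (σ i)) ∩ C (σ j)).ncard ≤ 3 := by
  obtain ⟨p, hp⟩ := exists_generic (V := V)
  have hH := hp.closed_glc G
  have hmax : ∀ i, Maximal (glc 2 G).IsClique (C i) := fun i => (hC i).1.maximal
  have hcov : ∀ S, (glc 2 G).IsClique S → 4 ≤ S.ncard → ∃ i, S ⊆ C i := by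
    intro S hS h4
    obtain ⟨X, hX, hSX⟩ := exists_isCluster_superset hS
    obtain ⟨i, rfl⟩ := hall X hX (h4.trans (Set.ncard_le_ncard hSX (Set.toFinite _)))
    exact ⟨i, hSX⟩
  have hshell := hH.exists_ncard_inter_le hp C (fun i => (hmax i).1)
    (fun i j hij => hH.ncard_inter_le hp (hmax i) (hmax j) fun h => hij (hinj h)) hcov
  refine ⟨?_, ?_⟩
  · have hpairs : ∀ i, pairs (C i) ⊆ (glc 2 G).edgeSet := by
      intro i e he
      induction e with | _ a b =>
      obtain ⟨hab, ha, hb⟩ := mk_mem_pairs.1 he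
      exact (hmax i).1 ha hb hab
    have hstress : stress p (glc 2 G).edgeSet = Finset.univ.sup fun i => stress p (pairs (C i)) := by
      refine le_antisymm (hH.stress_le hp _ fun S hS hcl => ?_)
        (Finset.sup_le fun i _ => stress_mono p (hpairs i))
      obtain ⟨i, hi⟩ := hcov S hcl hS.ge
      exact (stress_mono p (pairs_mono hi)).trans
        (Finset.le_sup (f := fun i => stress p (pairs (C i))) (Finset.mem_univ i))
    have hrank : rd 2 G.edgeSet = Module.finrank ℝ (rowSpan p (glc 2 G).edgeSet) := by
      rw [hp.rd_eq, le_antisymm (rowSpan_mono p (SimpleGraph.edgeSet_mono (le_glc 2 G)))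
        (rowSpan_le fun e he => hp.inCl_of_mem_glc he)]
    have hFP : F = (glc 2 G).edgeSet \ ⋃ i, pairs (C i) := by
      ext e
      simp only [hF, Set.mem_ofPred_eq, Set.mem_sdiff, Set.mem_iUnion]
      constructor
      · rintro ⟨he, hni⟩
        exact ⟨SimpleGraph.edgeSet_mono (le_glc 2 G) he, fun ⟨i, hi⟩ => hni ⟨i, hi.2⟩⟩
      · rintro ⟨he, hni⟩
        refine ⟨?_, fun ⟨i, hi⟩ => hni ⟨i, SimpleGraph.not_isDiag_of_mem_edgeSet _ he, hi⟩⟩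
        by_contra heG
        obtain ⟨ω, hω, hωe⟩ := (hp.inCl_of_mem_glc he).exists_stress heG
        have hω' := stress_mono p (Set.insert_subset he (SimpleGraph.edgeSet_mono (le_glc 2 G))) hω
        rw [hstress] at hω'
        exact hωe (sup_stress_le_suppOn C _ hω' e (by simpa using hni))
    have hedges : F.ncard + (⋃ i, pairs (C i)).ncard = (glc 2 G).edgeSet.ncard := by
      rw [hFP]
      exact Set.ncard_sdiff_add_ncard_of_subset (Set.iUnion_subset hpairs)
    have hmult := sum_multiplicity fun i => pairs (C i)
    have hterm : ∀ e : Sym2 V, (if ¬ e.IsDiag ∧ 2 ≤ {i : Fin s | ∀ w ∈ e, w ∈ C i}.ncard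
        then {i : Fin s | ∀ w ∈ e, w ∈ C i}.ncard - 1 else 0) = {i | e ∈ pairs (C i)}.ncard - 1 := by
      intro e
      by_cases hd : e.IsDiag
      · simp [hd, pairs]
      · have : {i | e ∈ pairs (C i)} = {i : Fin s | ∀ w ∈ e, w ∈ C i} := by
          ext i; simp [pairs, hd]
        rw [this]
        simp only [hd, not_false_eq_true, true_and]
        split_ifs <;> omega
    have hdim := finrank_rowSpan_add p (glc 2 G).edgeSet
    rw [hstress, hp.finrank_sup_stress C hshell, ← hrank] at hdim
    rw [Finset.sum_congr rfl fun e _ => hterm e]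
    have hsum : ∑ i, Module.finrank ℝ (stress p (pairs (C i))) + ∑ i, (2 * (C i).ncard - 3) =
        ∑ i, (pairs (C i)).ncard := by
      rw [← Finset.sum_add_distrib]
      refine Finset.sum_congr rfl fun i _ => ?_
      have h4 := (hC i).2
      have h1 := finrank_rowSpan_add p (pairs (C i))
      have h2 := hp.finrank_rowSpan_add_three (U := C i) (by omega)
      omega
    omega
  · obtain ⟨f, hf, -, hsh⟩ := exists_shelling C hshell s Finset.univ (by simp)
    exact ⟨Equiv.ofBijective f (Finite.injective_iff_bijective.1 hf), hsh⟩

end Rigidity
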